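/- arXiv:2211.00180 — 6 statements merged into one kernel-verified Lean document; each statement's English description precedes it below -/
import Mathlib

section
/- Let 0 < γ ≤ 1. Then Φ_γ(0) = 0, Φ_γ is strictly increasing on the interval [0, γ), and consequently Φ_γ(Y) > 0 for every Y ∈ (0, γ). -/
/-- `r_*(Y) = (√(Y²+4) − Y)/2`. -/
noncomputable def rstar (Y : ℝ) : ℝ := (Real.sqrt (Y ^ 2 + 4) - Y) / 2

/-- The large deviation rate function
`Φ_γ(Y) = Y(γ−Y) − log((γ−Y)/γ) − Y·r_*(Y) + 2·log r_*(Y)`. -/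
noncomputable def Phi (γ Y : ℝ) : ℝ :=
  Y * (γ - Y) - Real.log ((γ - Y) / γ) - Y * rstar Y + 2 * Real.log (rstar Y)

theorem Phi_hasDerivAt (γ Y : ℝ) (h0 : 0 < γ) (hY : Y < γ) :
    HasDerivAt (Phi γ) ((γ - Y) + 1 / (γ - Y) - Real.sqrt (Y ^ 2 + 4)) Y := by
  have hp : 0 < Y ^ 2 + 4 := by positivity
  have hs : 0 < Real.sqrt (Y ^ 2 + 4) := Real.sqrt_pos.2 hp
  have hsq : Real.sqrt (Y ^ 2 + 4) ^ 2 = Y ^ 2 + 4 := Real.sq_sqrt hp.le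
  have hr : 0 < rstar Y := by
    unfold rstar
    have : Y < Real.sqrt (Y ^ 2 + 4) := by
      apply Real.lt_sqrt_of_sq_lt
      linarith
    linarith
  have ht : 0 < γ - Y := by linarith
  have hid := hasDerivAt_id' Y
  have hsd := (((hid.pow 2).add_const (4 : ℝ)).sqrt hp.ne')
  have hrd : HasDerivAt rstar (-(rstar Y) / Real.sqrt (Y ^ 2 + 4)) Y := by
    have h := (hsd.sub hid).div_const 2
    refine HasDerivAt.congr_deriv (f := rstar) h ?_
    unfold rstar
    simp only [Pi.pow_apply]
    field_simp
    push_cast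
    ring
  have hg := hid.const_sub γ
  have hl := (hg.div_const γ).log (div_pos ht h0).ne'
  have h := (((hid.mul hg).sub hl).sub (hid.mul hrd)).add ((hrd.log hr.ne').const_mul 2)
  refine HasDerivAt.congr_deriv (f := Phi γ) h ?_
  have e1 : 2 * (-rstar Y / Real.sqrt (Y ^ 2 + 4) / rstar Y) = -2 / Real.sqrt (Y ^ 2 + 4) := by
    field_simp
  have e2 : -1 / γ / ((γ - Y) / γ) = - (1 / (γ - Y)) := by
    field_simp
  rw [e1, e2]
  unfold rstar
  generalize Real.sqrt (Y ^ 2 + 4) = s at *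
  generalize 1 / (γ - Y) = u at *
  field_simp
  linear_combination hsq

theorem Phi_strictMono_of_gamma_le_one (γ : ℝ) (h0 : 0 < γ) (h1 : γ ≤ 1) :
    Phi γ 0 = 0 ∧ StrictMonoOn (Phi γ) (Set.Ico 0 γ) ∧
      ∀ Y ∈ Set.Ioo 0 γ, 0 < Phi γ Y := by
  have hz : Phi γ 0 = 0 := by
    have : Real.sqrt 4 = 2 := by
      rw [show (4 : ℝ) = 2 ^ 2 by norm_num]
      exact Real.sqrt_sq (by norm_num)
    simp [Phi, rstar, this, h0.ne']
  have hm : StrictMonoOn (Phi γ) (Set.Ico 0 γ) := by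
    apply strictMonoOn_of_deriv_pos (convex_Ico 0 γ)
    · intro Y hY
      exact (Phi_hasDerivAt γ Y h0 hY.2).continuousAt.continuousWithinAt
    · intro Y hY
      rw [interior_Ico] at hY
      obtain ⟨hY0, hY1⟩ := hY
      rw [(Phi_hasDerivAt γ Y h0 hY1).deriv]
      have ht : 0 < γ - Y := by linarith
      have hu : 1 < 1 / (γ - Y) := by
        rw [lt_div_iff₀ ht]; linarith
      have htu : (γ - Y) * (1 / (γ - Y)) = 1 := by field_simp
      generalize 1 / (γ - Y) = u at *
      have : Real.sqrt (Y ^ 2 + 4) < (γ - Y) + u := by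
        rw [Real.sqrt_lt' (by linarith)]
        have : Y ^ 2 < (u - (γ - Y)) ^ 2 := by
          apply pow_lt_pow_left₀ _ hY0.le (by norm_num)
          linarith
        nlinarith
      linarith
  refine ⟨hz, hm, fun Y hY => ?_⟩
  rw [← hz]
  exact hm ⟨le_rfl, h0⟩ ⟨hY.1.le, hY.2⟩ hY.1
end

section
/- Let γ > 1 and set Y_* = γ − γ⁻¹ ∈ (0, γ). Then Φ_γ(Y) ≥ 0 for all Y ∈ [0, γ), Φ_γ(0) = 0, Φ_γ(Y_*) = 0, and Φ_γ(Y) > 0 for every Y ∈ (0, γ) with Y ≠ Y_*; in particular Y = 0 and Y = Y_* are the only zeros of Φ_γ on [0, γ). -/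
theorem rstar_pos_aux (Y : ℝ) : 0 < rstar Y := by
  unfold rstar
  have h : Y < Real.sqrt (Y ^ 2 + 4) := by
    apply Real.lt_sqrt_of_sq_lt
    linarith
  linarith

theorem rstar_eq_aux (Y : ℝ) : rstar Y * (Y + rstar Y) = 1 := by
  unfold rstar
  have h : Real.sqrt (Y ^ 2 + 4) ^ 2 = Y ^ 2 + 4 := Real.sq_sqrt (by positivity)
  linear_combination h / 4

theorem rstar_unique_aux (Y s : ℝ) (hs : 0 < s) (h : s * (Y + s) = 1) : rstar Y = s := by
  have hr := rstar_pos_aux Y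
  have he := rstar_eq_aux Y
  have h1 : (rstar Y - s) * (rstar Y * s + 1) = 0 := by
    linear_combination s * he - rstar Y * h
  have h2 : rstar Y * s + 1 ≠ 0 := by positivity
  rcases mul_eq_zero.1 h1 with h3 | h3
  · linarith
  · exact absurd h3 h2

theorem Phi_pos_aux (γ Y : ℝ) (h0 : 0 < Y) (h1 : Y < γ) (hne : Y ≠ γ - γ⁻¹) :
    0 < Phi γ Y := by
  have hr := rstar_pos_aux Y
  have he := rstar_eq_aux Y
  unfold Phi
  set r := rstar Y
  have hγ : 0 < γ := h0.trans h1
  have ha : 0 < γ - Y := sub_pos.2 h1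
  have har : γ - Y - r ≠ 0 := by
    intro h
    apply hne
    have h2 : r * γ = 1 := by linear_combination he + r * h
    have h3 : r = γ⁻¹ := eq_inv_of_mul_eq_one_left h2
    linarith
  have hlog : Real.log ((γ - Y) / γ / r ^ 2) = Real.log ((γ - Y) / γ) - 2 * Real.log r := by
    rw [Real.log_div (by positivity) (by positivity), Real.log_pow]
    norm_num
  have hle := Real.log_le_sub_one_of_pos (show 0 < (γ - Y) / γ / r ^ 2 by positivity)
  have hid : Y * (γ - Y - r) - ((γ - Y) / γ / r ^ 2 - 1) = Y * (γ - Y - r) ^ 2 / γ := by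
    have hinv : 1 / r = Y + r := by
      field_simp
      linarith
    have h2 : (γ - Y) / γ / r ^ 2 = (γ - Y) / γ * (Y + r) ^ 2 := by
      rw [← hinv]
      field_simp
    have h3 : (γ - Y) / γ * (Y + r) ^ 2 - 1 = Y * (γ - Y - r) * (Y + r) / γ := by
      field_simp
      linear_combination γ * he
    rw [h2, h3]
    field_simp
    ring
  have : 0 < Y * (γ - Y - r) ^ 2 / γ := by positivity
  linarith

theorem Phi_zeros_of_one_lt_gamma (γ : ℝ) (hγ : 1 < γ) :
    γ - γ⁻¹ ∈ Set.Ioo 0 γ ∧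
    (∀ Y ∈ Set.Ico 0 γ, 0 ≤ Phi γ Y) ∧
    Phi γ 0 = 0 ∧
    Phi γ (γ - γ⁻¹) = 0 ∧
    (∀ Y ∈ Set.Ioo 0 γ, Y ≠ γ - γ⁻¹ → 0 < Phi γ Y) ∧
    (∀ Y ∈ Set.Ico 0 γ, Phi γ Y = 0 → Y = 0 ∨ Y = γ - γ⁻¹) := by
  have hp : 0 < γ := by linarith
  have hinv : 0 < γ⁻¹ := inv_pos.2 hp
  have hinv1 : γ⁻¹ < 1 := inv_lt_one_of_one_lt₀ hγ
  have hz : Phi γ 0 = 0 := by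
    have : rstar 0 = 1 := rstar_unique_aux 0 1 one_pos (by norm_num)
    unfold Phi
    rw [this]
    simp [hp.ne']
  have hs : Phi γ (γ - γ⁻¹) = 0 := by
    have : rstar (γ - γ⁻¹) = γ⁻¹ := rstar_unique_aux _ _ hinv (by rw [sub_add_cancel]; exact inv_mul_cancel₀ hp.ne')
    unfold Phi
    rw [this, sub_sub_cancel, Real.log_div hinv.ne' hp.ne', Real.log_inv]
    ring
  have hpos : ∀ Y ∈ Set.Ioo 0 γ, Y ≠ γ - γ⁻¹ → 0 < Phi γ Y :=
    fun Y hY hne => Phi_pos_aux γ Y hY.1 hY.2 hne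
  have hzero : ∀ Y ∈ Set.Ico 0 γ, Y = 0 ∨ Y = γ - γ⁻¹ ∨ 0 < Phi γ Y := by
    intro Y hY
    by_cases h0 : Y = 0
    · exact Or.inl h0
    by_cases h1 : Y = γ - γ⁻¹
    · exact Or.inr (Or.inl h1)
    exact Or.inr (Or.inr (hpos Y ⟨lt_of_le_of_ne hY.1 (Ne.symm h0), hY.2⟩ h1))
  refine ⟨⟨by linarith, by linarith⟩, ?_, hz, hs, hpos, ?_⟩
  · intro Y hY
    rcases hzero Y hY with h | h | h
    · rw [h, hz]
    · rw [h, hs]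
    · exact h.le
  · intro Y hY h
    rcases hzero Y hY with h' | h' | h'
    · exact Or.inl h'
    · exact Or.inr h'
    · exact absurd h h'.ne'
end

section
/- Let γ > 1, and set Y_* = γ − γ⁻¹ and Y_{**} = (3γ − √(8+γ²))/4 = 2(γ−γ⁻¹)/(3+√(1+8γ⁻²)). Then 0 < Y_{**} < Y_* < γ, the points Y_{**} and Y_* are the only critical points of Φ_γ in the open interval (0, γ), Y_{**} is a strict local maximum of Φ_γ, Y_* is a strict local minimum of Φ_γ, and the second derivative of Φ_γ at Y_* equals γ²(γ²−1)/(γ²+1) > 0. -/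
lemma aux_hasDerivAt (γ Y : ℝ) (hγ : 1 < γ) (hY : Y < γ) :
    HasDerivAt (Phi γ) (γ - Y + 1 / (γ - Y) - Real.sqrt (Y ^ 2 + 4)) Y := by
  have hu : 0 < γ - Y := by linarith
  have hpos : 0 < Y ^ 2 + 4 := by positivity
  have hs : 0 < Real.sqrt (Y ^ 2 + 4) := Real.sqrt_pos.mpr hpos
  have hs2 : Real.sqrt (Y ^ 2 + 4) ^ 2 = Y ^ 2 + 4 := Real.sq_sqrt hpos.le
  have hr : 0 < rstar Y := by
    unfold rstar
    have : Y < Real.sqrt (Y ^ 2 + 4) := by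
      apply Real.lt_sqrt_of_sq_lt; linarith
    linarith
  have hid := hasDerivAt_id' Y
  have h1 : HasDerivAt (fun Y : ℝ => Y ^ 2 + 4) (2 * Y) Y := by
    simpa using (hid.pow 2).add_const 4
  have h2 := h1.sqrt hpos.ne'
  have h3 : HasDerivAt rstar ((2 * Y / (2 * Real.sqrt (Y ^ 2 + 4)) - 1) / 2) Y :=
    (h2.sub hid).div_const 2
  have h4 : HasDerivAt (fun Y => γ - Y) (-1) Y := hid.const_sub γ
  have h5 := (h4.div_const γ).log (div_pos hu (by linarith)).ne'
  have h6 := (((hid.mul h4).sub h5).sub (hid.mul h3)).add ((h3.log hr.ne').const_mul 2)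
  have h7 : HasDerivAt (Phi γ) _ Y := h6
  convert h7 using 1
  have hr' : Real.sqrt (Y ^ 2 + 4) = 2 * rstar Y + Y := by unfold rstar; ring
  rw [hr'] at hs hs2 ⊢
  generalize rstar Y = r at *
  have hq : r ^ 2 + Y * r = 1 := by linarith
  have hY' : Y = 1 / r - r := by field_simp; linarith
  have hγ0 : γ ≠ 0 := by linarith
  have e1 : -1 / γ / ((γ - Y) / γ) = - (1 / (γ - Y)) := by field_simp
  have e2 : (2 * Y / (2 * (2 * r + Y)) - 1) / 2 = - r / (2 * r + Y) := by field_simp; ring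
  rw [e1, e2]
  have e3 : - r / (2 * r + Y) / r = - 1 / (2 * r + Y) := by field_simp
  rw [e3]
  have e4 : Y * (- r / (2 * r + Y)) - 2 * (- 1 / (2 * r + Y)) = r := by
    have hne := hs.ne'
    rw [mul_div_assoc', mul_div_assoc', ← sub_div, div_eq_iff hne]
    linear_combination (-2) * hq
  linarith

lemma aux_factor (γ Y : ℝ) (hγ : 1 < γ) (hY : Y < γ) :
    ∃ P > 0, γ - Y + 1 / (γ - Y) - Real.sqrt (Y ^ 2 + 4) =
      P * (((3 * γ - Real.sqrt (8 + γ ^ 2)) / 4 - Y) * (γ - γ⁻¹ - Y)) := by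
  have hu : 0 < γ - Y := by linarith
  have hs0 := Real.sqrt_nonneg (Y ^ 2 + 4)
  have hs2 : Real.sqrt (Y ^ 2 + 4) ^ 2 = Y ^ 2 + 4 := Real.sq_sqrt (by positivity)
  have hq2 : Real.sqrt (8 + γ ^ 2) ^ 2 = 8 + γ ^ 2 := Real.sq_sqrt (by positivity)
  have hq : γ < Real.sqrt (8 + γ ^ 2) := by
    apply Real.lt_sqrt_of_sq_lt; linarith
  generalize Real.sqrt (8 + γ ^ 2) = q at *
  generalize Real.sqrt (Y ^ 2 + 4) = s at *
  obtain ⟨u, rfl⟩ : ∃ u, Y = γ - u := ⟨γ - Y, by ring⟩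
  have hu' : 0 < u := by linarith
  have hD : 0 < u + 1 / u + s := by positivity
  have hk : 0 < u + (q - γ) / 4 := by linarith
  refine ⟨2 * (u + (q - γ) / 4) * γ / (u ^ 2 * (u + 1 / u + s)), by positivity, ?_⟩
  have e : γ - (γ - u) = u := by ring
  rw [e]
  have h1 : (u + 1 / u - s) * (u + 1 / u + s) = (u + 1 / u) ^ 2 - ((γ - u) ^ 2 + 4) := by
    rw [← hs2]; ring
  have h2 : u ^ 2 * ((u + 1 / u) ^ 2 - ((γ - u) ^ 2 + 4)) =
      (2 * u ^ 2 - γ * u - 1) * (γ * u - 1) := by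
    field_simp; ring
  have h3 : 2 * ((u + (q - γ) / 4) * ((3 * γ - q) / 4 - (γ - u))) = 2 * u ^ 2 - γ * u - 1 := by
    linear_combination (-1 / 8) * hq2
  have h4 : γ * (γ - γ⁻¹ - (γ - u)) = γ * u - 1 := by field_simp; ring
  rw [div_mul_eq_mul_div, eq_div_iff (by positivity)]
  rw [← h3, ← h4, ← h1] at h2
  linear_combination h2

/-- For `γ > 1`, with `Y_* = γ − γ⁻¹` and
`Y_{**} = (3γ − √(8+γ²))/4 = 2(γ−γ⁻¹)/(3+√(1+8γ⁻²))`: one has `0 < Y_{**} < Y_* < γ`,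
the points `Y_{**}` and `Y_*` are the only critical points of `Φ_γ` on `(0, γ)`,
`Y_{**}` is a strict local maximum, `Y_*` is a strict local minimum, and
`Φ_γ''(Y_*) = γ²(γ²−1)/(γ²+1) > 0`. -/
theorem Phi_critical_points_of_one_lt_gamma (γ : ℝ) (hγ : 1 < γ) :
    (3 * γ - Real.sqrt (8 + γ ^ 2)) / 4
        = 2 * (γ - γ⁻¹) / (3 + Real.sqrt (1 + 8 / γ ^ 2)) ∧
    0 < (3 * γ - Real.sqrt (8 + γ ^ 2)) / 4 ∧
    (3 * γ - Real.sqrt (8 + γ ^ 2)) / 4 < γ - γ⁻¹ ∧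
    γ - γ⁻¹ < γ ∧
    (∀ Y ∈ Set.Ioo 0 γ,
      deriv (Phi γ) Y = 0 ↔
        (Y = (3 * γ - Real.sqrt (8 + γ ^ 2)) / 4 ∨ Y = γ - γ⁻¹)) ∧
    (∃ ε > 0, ∀ Y : ℝ, |Y - (3 * γ - Real.sqrt (8 + γ ^ 2)) / 4| < ε →
      Y ≠ (3 * γ - Real.sqrt (8 + γ ^ 2)) / 4 →
      Phi γ Y < Phi γ ((3 * γ - Real.sqrt (8 + γ ^ 2)) / 4)) ∧
    (∃ ε > 0, ∀ Y : ℝ, |Y - (γ - γ⁻¹)| < ε → Y ≠ γ - γ⁻¹ →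
      Phi γ (γ - γ⁻¹) < Phi γ Y) ∧
    deriv (deriv (Phi γ)) (γ - γ⁻¹) = γ ^ 2 * (γ ^ 2 - 1) / (γ ^ 2 + 1) ∧
    0 < γ ^ 2 * (γ ^ 2 - 1) / (γ ^ 2 + 1) := by
  have h0 : 0 < γ := by linarith
  have hq2 : Real.sqrt (8 + γ ^ 2) ^ 2 = 8 + γ ^ 2 := Real.sq_sqrt (by positivity)
  have hq0 : 0 ≤ Real.sqrt (8 + γ ^ 2) := Real.sqrt_nonneg _
  have hqq : Real.sqrt (1 + 8 / γ ^ 2) = Real.sqrt (8 + γ ^ 2) / γ := by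
    rw [show 1 + 8 / γ ^ 2 = (8 + γ ^ 2) / γ ^ 2 by field_simp; ring,
      Real.sqrt_div (by positivity), Real.sqrt_sq h0.le]
  have hfac := fun Y hY => aux_factor γ Y hγ hY
  have hder := fun Y hY => aux_hasDerivAt γ Y hγ hY
  rw [hqq]
  generalize Real.sqrt (8 + γ ^ 2) = q at *
  have hi : γ * γ⁻¹ = 1 := mul_inv_cancel₀ h0.ne'
  have hi0 : 0 < γ⁻¹ := by positivity
  have hi1 : γ⁻¹ < 1 := inv_lt_one_of_one_lt₀ hγ
  have A1 : (3 * γ - q) / 4 = 2 * (γ - γ⁻¹) / (3 + q / γ) := by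
    rw [eq_div_iff (by positivity)]
    field_simp
    linear_combination - hq2
  have A2 : 0 < (3 * γ - q) / 4 := by
    have : q < 3 * γ := by
      apply lt_of_pow_lt_pow_left₀ 2 (by positivity)
      nlinarith
    linarith
  have A3 : (3 * γ - q) / 4 < γ - γ⁻¹ := by
    have : 4 * γ⁻¹ - γ < q := by
      apply lt_of_pow_lt_pow_left₀ 2 hq0
      nlinarith
    linarith
  have A4 : γ - γ⁻¹ < γ := by linarith
  generalize (3 * γ - q) / 4 = a at *
  have D2 : deriv (deriv (Phi γ)) (γ - γ⁻¹) = γ ^ 2 * (γ ^ 2 - 1) / (γ ^ 2 + 1) := by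
    have hev : deriv (Phi γ) =ᶠ[nhds (γ - γ⁻¹)]
        fun Y => γ - Y + 1 / (γ - Y) - Real.sqrt (Y ^ 2 + 4) := by
      filter_upwards [Iio_mem_nhds A4] with Y hY
      exact (hder Y hY).deriv
    rw [hev.deriv_eq]
    have hs : Real.sqrt ((γ - γ⁻¹) ^ 2 + 4) = γ + γ⁻¹ := by
      rw [show (γ - γ⁻¹) ^ 2 + 4 = (γ + γ⁻¹) ^ 2 by linear_combination (-4) * hi]
      exact Real.sqrt_sq (by positivity)
    have hid := hasDerivAt_id' (γ - γ⁻¹)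
    have h1 : HasDerivAt (fun Y : ℝ => Y ^ 2 + 4) (2 * (γ - γ⁻¹)) (γ - γ⁻¹) := by
      simpa using (hid.pow 2).add_const 4
    have h2 := h1.sqrt (by positivity)
    have h4 : HasDerivAt (fun Y => γ - Y) (-1) (γ - γ⁻¹) := hid.const_sub γ
    have h5 := (hasDerivAt_const (γ - γ⁻¹) (1 : ℝ)).div h4 (by simpa using h0.ne')
    have h6 := (h4.add h5).sub h2
    refine Eq.trans (HasDerivAt.deriv h6) ?_
    rw [hs, show γ - (γ - γ⁻¹) = γ⁻¹ by ring]
    field_simp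
    ring
  have D3 : 0 < γ ^ 2 * (γ ^ 2 - 1) / (γ ^ 2 + 1) := by
    have : 0 < γ ^ 2 - 1 := by nlinarith
    positivity
  generalize γ - γ⁻¹ = b at *
  have hdv : ∀ Y < γ, ∃ P > 0, deriv (Phi γ) Y = P * ((a - Y) * (b - Y)) := by
    intro Y hY
    obtain ⟨P, hP, h⟩ := hfac Y hY
    exact ⟨P, hP, by rw [(hder Y hY).deriv, h]⟩
  have hcont : ∀ s ⊆ Set.Iio γ, ContinuousOn (Phi γ) s := fun s hs Y hY =>
    (hder Y (hs hY)).continuousAt.continuousWithinAt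
  have M1 : StrictMonoOn (Phi γ) (Set.Iic a) := by
    apply strictMonoOn_of_deriv_pos (convex_Iic a) (hcont _ fun Y hY => ?_) fun Y hY => ?_
    · simp only [Set.mem_Iic, Set.mem_Iio] at *; linarith
    · simp only [interior_Iic, Set.mem_Iio] at hY
      obtain ⟨P, hP, h⟩ := hdv Y (by linarith)
      rw [h]
      exact mul_pos hP (mul_pos (by linarith) (by linarith))
  have M2 : StrictAntiOn (Phi γ) (Set.Icc a b) := by
    apply strictAntiOn_of_deriv_neg (convex_Icc a b) (hcont _ fun Y hY => ?_) fun Y hY => ?_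
    · simp only [Set.mem_Icc, Set.mem_Iio] at *; linarith
    · simp only [interior_Icc, Set.mem_Ioo] at hY
      obtain ⟨P, hP, h⟩ := hdv Y (by linarith)
      rw [h]
      exact mul_neg_of_pos_of_neg hP (mul_neg_of_neg_of_pos (by linarith) (by linarith))
  have M3 : StrictMonoOn (Phi γ) (Set.Ico b γ) := by
    apply strictMonoOn_of_deriv_pos (convex_Ico b γ) (hcont _ fun Y hY => ?_) fun Y hY => ?_
    · exact hY.2
    · simp only [interior_Ico, Set.mem_Ioo] at hY
      obtain ⟨P, hP, h⟩ := hdv Y (by linarith)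
      rw [h]
      exact mul_pos hP (mul_pos_of_neg_of_neg (by linarith) (by linarith))
  refine ⟨A1, A2, A3, A4, ?_, ⟨b - a, by linarith, ?_⟩,
    ⟨min (b - a) (γ - b), lt_min (by linarith) (by linarith), ?_⟩, D2, D3⟩
  · intro Y hY
    obtain ⟨P, hP, h⟩ := hdv Y hY.2
    rw [h, mul_eq_zero, mul_eq_zero, sub_eq_zero, sub_eq_zero]
    constructor
    · rintro (h | h | h)
      · exact absurd h hP.ne'
      · exact Or.inl h.symm
      · exact Or.inr h.symm
    · rintro (h | h)
      · exact Or.inr (Or.inl h.symm)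
      · exact Or.inr (Or.inr h.symm)
  · intro Y hY hne
    rw [abs_lt] at hY
    rcases lt_or_gt_of_ne hne with h | h
    · exact M1 h.le (Set.mem_Iic.mpr le_rfl) h
    · exact M2 ⟨le_rfl, A3.le⟩ ⟨h.le, by linarith⟩ h
  · intro Y hY hne
    rw [lt_min_iff, abs_lt, abs_lt] at hY
    rcases lt_or_gt_of_ne hne with h | h
    · exact M2 ⟨by linarith, h.le⟩ ⟨A3.le, le_rfl⟩ h
    · exact M3 ⟨le_rfl, A4⟩ ⟨h.le, by linarith⟩ h
end

section
/- Fix γ > 0 and Y ∈ (0, γ) such that r_*(Y)·(γ − Y) ≠ 1 (equivalently Ψ_γ(Y) ≠ 0). Then the exact mean density of imaginary parts satisfies the large deviation asymptotics lim_{N→∞} √N · e^{N·Φ_γ(Y)} · ρ_N^γ(Y) / Ψ_γ(Y) = 1. -/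
/-- The generalized Laguerre polynomial
`L_n^{(α)}(x) = Σ_{k=0}^n (−1)^k · binom(n+α, n−k) · x^k/k!`. -/
noncomputable def Lag (n α : ℕ) (x : ℝ) : ℝ :=
  ∑ k ∈ Finset.range (n + 1),
    (-1 : ℝ) ^ k * ((n + α).choose (n - k) : ℝ) * x ^ k / (Nat.factorial k : ℝ)

/-- The exact mean density of the imaginary parts of the eigenvalues of the rank-one
non-Hermitian deformation `J = H + iγ·diag(1,0,…,0)` of the `N×N` GUE. -/
noncomputable def rhoIm (N : ℕ) (γ Y : ℝ) : ℝ :=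
  (1 / (Y * γ)) * (1 - Y / γ) ^ (N - 2) * Real.exp (-(N : ℝ) * Y * (γ - Y)) *
    (((N : ℝ) - 1) / (N : ℝ) * (3 * Y - 2 * γ) * Lag (N - 1) 1 (-(N : ℝ) * Y ^ 2)
      + (2 * γ - 2 * Y + Y * (γ - Y) ^ 2) * Lag (N - 2) 1 (-(N : ℝ) * Y ^ 2))

/-- The pre-exponential factor
`Ψ_γ(Y) = (1/√(2π)) · (γ/(γ−Y)²) · (1 − r_*(Y)(γ−Y))² / (Y^{3/2}·(Y²+4)^{1/4})`. -/
noncomputable def Psi (γ Y : ℝ) : ℝ :=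
  (1 / Real.sqrt (2 * Real.pi)) * (γ / (γ - Y) ^ 2) *
    (1 - rstar Y * (γ - Y)) ^ 2 / (Y ^ ((3 : ℝ) / 2) * (Y ^ 2 + 4) ^ ((1 : ℝ) / 4))

open Filter Topology MeasureTheory Complex

lemma exp_quad : ∃ E : ℂ → ℂ, (∀ z, cexp z = 1 + z + z ^ 2 * E z) ∧
    Tendsto E (𝓝 0) (𝓝 (1 / 2)) := by
  refine ⟨fun z => if z = 0 then 1 / 2 else (cexp z - 1 - z) / z ^ 2, ?_, ?_⟩
  · intro z
    by_cases hz : z = 0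
    · simp [hz]
    · simp only [hz, if_false]; field_simp; ring
  · rw [tendsto_iff_norm_sub_tendsto_zero]
    have hlim : Tendsto (fun z : ℂ => ‖z‖ * Real.exp ‖z‖) (𝓝 0) (𝓝 0) := by
      have : Continuous (fun z : ℂ => ‖z‖ * Real.exp ‖z‖) := by fun_prop
      simpa using this.tendsto 0
    refine squeeze_zero (fun _ => norm_nonneg _) ?_ hlim
    intro z
    by_cases hz : z = 0
    · simp [hz]
    · simp only [hz, if_false]
      have h := Complex.norm_exp_sub_sum_le_norm_mul_exp z 3
      simp only [Finset.sum_range_succ, Finset.range_zero, Finset.sum_empty] at h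
      norm_num [Nat.factorial] at h
      have hz' : 0 < ‖z‖ := norm_pos_iff.mpr hz
      have e : (cexp z - 1 - z) / z ^ 2 - 1 / 2 = (cexp z - (1 + z + z ^ 2 / 2)) / z ^ 2 := by
        field_simp; ring
      rw [e, norm_div, norm_pow, div_le_iff₀ (by positivity)]
      calc _ ≤ _ := h
        _ = _ := by ring

/-- characteristic function of a centred Bernoulli minus Poisson variable (conjugated) -/
noncomputable def gg (p θ : ℝ) : ℂ :=
  (1 - p + p * cexp (-(θ * I))) * cexp (p * (cexp (θ * I) - 1))

lemma gg_cont (p : ℝ) : Continuous (gg p) := by unfold gg; fun_prop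

lemma gg_norm (p θ : ℝ) (hp : 0 ≤ p) (hp1 : p ≤ 1) :
    ‖gg p θ‖ ≤ Real.exp (-(p * (1 - Real.cos θ))) := by
  unfold gg
  rw [norm_mul, Complex.norm_exp]
  have h1 : ‖(1 - p + p * cexp (-(θ * I)) : ℂ)‖ ≤ 1 := by
    refine (norm_add_le _ _).trans ?_
    have e1 : ‖(1 - p : ℂ)‖ = 1 - p := by
      rw [← Complex.ofReal_one, ← Complex.ofReal_sub, Complex.norm_real, Real.norm_of_nonneg]
      linarith
    have e2 : ‖cexp (-(θ * I))‖ = 1 := by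
      have := Complex.norm_exp_ofReal_mul_I (-θ)
      rwa [Complex.ofReal_neg, neg_mul] at this
    rw [norm_mul, e1, e2, Complex.norm_real, Real.norm_of_nonneg hp]; linarith
  have h2 : ((p : ℂ) * (cexp (θ * I) - 1)).re = -(p * (1 - Real.cos θ)) := by
    rw [Complex.re_ofReal_mul, Complex.sub_re, Complex.exp_ofReal_mul_I_re]; simp; ring
  rw [h2]
  calc _ ≤ 1 * Real.exp (-(p * (1 - Real.cos θ))) := by gcongr
    _ = _ := one_mul _

lemma gg_taylor (p : ℝ) : Tendsto (fun θ : ℝ => (gg p θ - 1) / (θ : ℂ) ^ 2) (𝓝[≠] 0)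
    (𝓝 (-(p * (2 - p)) / 2 : ℂ)) := by
  obtain ⟨E, hE, hl⟩ := exp_quad
  have t1 : Tendsto (fun θ : ℝ => E (θ * I)) (𝓝 0) (𝓝 (1 / 2)) := by
    apply hl.comp
    have : Continuous (fun θ : ℝ => (θ * I : ℂ)) := by fun_prop
    simpa using this.tendsto 0
  have t2 : Tendsto (fun θ : ℝ => E (-(θ * I))) (𝓝 0) (𝓝 (1 / 2)) := by
    apply hl.comp
    have : Continuous (fun θ : ℝ => (-(θ * I) : ℂ)) := by fun_prop
    simpa using this.tendsto 0
  have t3 : Tendsto (fun θ : ℝ => E (p * (cexp (θ * I) - 1))) (𝓝 0) (𝓝 (1 / 2)) := by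
    apply hl.comp
    have : Continuous (fun θ : ℝ => (p * (cexp (θ * I) - 1) : ℂ)) := by fun_prop
    simpa using this.tendsto 0
  have t0 : Tendsto (fun θ : ℝ => (θ : ℂ)) (𝓝 0) (𝓝 0) := by
    simpa using Complex.continuous_ofReal.tendsto 0
  -- quotients
  have key : Tendsto (fun θ : ℝ => -(p : ℂ) * (E (θ * I) + E (-(θ * I)))
      + p ^ 2 * ((-I - θ * E (-(θ * I))) * (I - θ * E (θ * I)))
      + p ^ 2 * (I - θ * E (θ * I)) ^ 2 * E (p * (cexp (θ * I) - 1)) *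
        (1 + p * (θ * (-I - θ * E (-(θ * I)))))) (𝓝 0)
      (𝓝 (-(p : ℂ) * (1 / 2 + 1 / 2)
      + p ^ 2 * ((-I - 0 * (1 / 2)) * (I - 0 * (1 / 2)))
      + p ^ 2 * (I - 0 * (1 / 2)) ^ 2 * (1 / 2) *
        (1 + p * (0 * (-I - 0 * (1 / 2)))))) := by
    have a1 := (tendsto_const_nhds (x := I)).sub (t0.mul t1)
    have a2 := (tendsto_const_nhds (x := -I)).sub (t0.mul t2)
    have a3 := ((t0.mul a2).const_mul (p : ℂ)).const_add 1
    exact (((t1.add t2).const_mul _).add ((a2.mul a1).const_mul _)).add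
      ((((a1.pow 2).const_mul _).mul t3).mul a3)
  have hv : (-(p : ℂ) * (1 / 2 + 1 / 2)
      + p ^ 2 * ((-I - 0 * (1 / 2)) * (I - 0 * (1 / 2)))
      + p ^ 2 * (I - 0 * (1 / 2)) ^ 2 * (1 / 2) *
        (1 + p * (0 * (-I - 0 * (1 / 2))))) = (-(p * (2 - p)) / 2 : ℂ) := by
    ring_nf; simp only [I_sq]; ring
  rw [hv] at key
  refine (key.mono_left nhdsWithin_le_nhds).congr' ?_
  filter_upwards [self_mem_nhdsWithin] with θ hθ
  have hθ' : (θ : ℂ) ≠ 0 := by exact_mod_cast hθ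
  have hw : cexp (-(θ * I)) = 1 + θ * (-I - θ * E (-(θ * I))) := by
    rw [hE (-(θ * I))]; ring_nf; simp only [I_sq]; ring
  have hv : cexp (θ * I) - 1 = θ * (I - θ * E (θ * I)) := by
    rw [hE (θ * I)]; ring_nf; simp only [I_sq]; ring
  unfold gg
  rw [hE (p * (cexp (θ * I) - 1)), hw]
  generalize E (p * (cexp (θ * I) - 1)) = e3
  rw [hv]
  rw [eq_div_iff (pow_ne_zero _ hθ')]
  ring

lemma gg_pow_lim (p t : ℝ) : Tendsto (fun N : ℕ => gg p (t / √N) ^ N) atTop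
    (𝓝 (cexp (-(p * (2 - p)) / 2 * t ^ 2))) := by
  by_cases ht : t = 0
  · subst ht; simp [gg]
  have h := Complex.tendsto_one_add_pow_exp_of_tendsto (g := fun N : ℕ => gg p (t / √N) - 1)
    (t := -(p * (2 - p)) / 2 * t ^ 2) ?_
  · simpa using h
  have hs : Tendsto (fun N : ℕ => t / √(N : ℝ)) atTop (𝓝[≠] 0) := by
    rw [tendsto_nhdsWithin_iff]
    refine ⟨Tendsto.const_div_atTop (Real.tendsto_sqrt_atTop.comp tendsto_natCast_atTop_atTop) _, ?_⟩
    filter_upwards [eventually_gt_atTop 0] with N hN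
    have : 0 < √(N : ℝ) := Real.sqrt_pos.mpr (by exact_mod_cast hN)
    exact div_ne_zero ht this.ne'
  refine (((gg_taylor p).comp hs).mul_const ((t : ℂ) ^ 2)).congr' ?_
  filter_upwards [eventually_gt_atTop 0] with N hN
  have hN' : (N : ℂ) ≠ 0 := by exact_mod_cast hN.ne'
  have ht' : (t : ℂ) ≠ 0 := by exact_mod_cast ht
  have e : ((t / √(N : ℝ) : ℝ) : ℂ) ^ 2 = t ^ 2 / N := by
    rw [← Complex.ofReal_pow, div_pow, Real.sq_sqrt (Nat.cast_nonneg _)]; push_cast; rfl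
  simp only [Function.comp]
  rw [e]
  field_simp

lemma local_limit (p : ℝ) (hp : 0 < p) (hp1 : p < 1) (φ : ℝ → ℂ) (hφ : Continuous φ) :
    Tendsto (fun N : ℕ => (√N : ℂ) * ∫ θ in (-Real.pi)..Real.pi, gg p θ ^ N * φ θ) atTop
      (𝓝 (φ 0 * √(Real.pi / (p * (2 - p) / 2)))) := by
  obtain ⟨C, hC⟩ := (isCompact_Icc (a := -Real.pi) (b := Real.pi)).exists_bound_of_continuousOn
    hφ.continuousOn
  have hC0 : 0 ≤ C := (norm_nonneg _).trans (hC 0 ⟨by linarith [Real.pi_pos], Real.pi_pos.le⟩)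
  set F : ℕ → ℝ → ℂ := fun N => Set.indicator (Set.Ioc (-(√N * Real.pi)) (√N * Real.pi))
    (fun t => gg p (t / √N) ^ N * φ (t / √N)) with hF
  have hlim : Tendsto (fun N => ∫ t, F N t) atTop
      (𝓝 (∫ t : ℝ, cexp (-(p * (2 - p)) / 2 * t ^ 2) * φ 0)) := by
    refine tendsto_integral_of_dominated_convergence
      (fun t => C * Real.exp (-(p * (2 / Real.pi ^ 2)) * t ^ 2)) ?_ ?_ ?_ ?_
    · intro N
      refine (Continuous.aestronglyMeasurable ?_).indicator measurableSet_Ioc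
      have := gg_cont p
      fun_prop
    · exact (integrable_exp_neg_mul_sq (by positivity)).const_mul C
    · intro N
      refine Eventually.of_forall fun t => ?_
      rw [hF]
      simp only [Set.indicator]
      split_ifs with h
      · rcases Nat.eq_zero_or_pos N with h0 | h0
        · subst h0; simp at h
        have hN : (0 : ℝ) < N := by exact_mod_cast h0
        have hsq : 0 < √(N : ℝ) := Real.sqrt_pos.mpr hN
        have hm : |t / √(N : ℝ)| ≤ Real.pi := by
          rw [abs_div, abs_of_pos hsq, div_le_iff₀ hsq, abs_le]
          constructor <;> linarith [h.1, h.2]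
        have hb := hC (t / √N) (abs_le.mp hm)
        have hc := Real.cos_le_one_sub_mul_cos_sq hm
        rw [norm_mul, norm_pow, mul_comm]
        gcongr
        calc ‖gg p (t / √N)‖ ^ N ≤ Real.exp (-(p * (1 - Real.cos (t / √N)))) ^ N := by
              gcongr; exact gg_norm p _ hp.le hp1.le
          _ ≤ Real.exp (-(p * (2 / Real.pi ^ 2 * (t / √N) ^ 2))) ^ N := by
              gcongr; linarith
          _ = _ := by
              rw [← Real.exp_nat_mul, div_pow, Real.sq_sqrt hN.le]
              congr 1; field_simp
      · simp only [norm_zero]; positivity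
    · refine Eventually.of_forall fun t => ?_
      have hs : Tendsto (fun N : ℕ => √(N : ℝ)) atTop atTop :=
        Real.tendsto_sqrt_atTop.comp tendsto_natCast_atTop_atTop
      have h1 : Tendsto (fun N : ℕ => t / √(N : ℝ)) atTop (𝓝 0) := hs.const_div_atTop _
      have h2 := (gg_pow_lim p t).mul ((hφ.tendsto 0).comp h1)
      refine h2.congr' ?_
      filter_upwards [hs.eventually_gt_atTop (|t| / Real.pi)] with N hN
      rw [div_lt_iff₀ Real.pi_pos] at hN
      have := abs_lt.mp hN
      rw [hF]
      simp only [Function.comp]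
      rw [Set.indicator_of_mem]
      exact ⟨this.1, this.2.le⟩
  have hval : (∫ t : ℝ, cexp (-(p * (2 - p)) / 2 * t ^ 2) * φ 0)
      = φ 0 * √(Real.pi / (p * (2 - p) / 2)) := by
    rw [integral_mul_const, mul_comm, ← integral_gaussian, ← integral_complex_ofReal]
    congr 2; ext t
    push_cast; congr 1; ring
  rw [hval] at hlim
  refine hlim.congr' ?_
  filter_upwards [eventually_gt_atTop 0] with N hN
  have hsq : 0 < √(N : ℝ) := Real.sqrt_pos.mpr (by exact_mod_cast hN)
  rw [hF]
  simp only
  rw [integral_indicator measurableSet_Ioc, ← intervalIntegral.integral_of_le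
    (by nlinarith [mul_pos hsq Real.pi_pos]),
    intervalIntegral.integral_comp_div (fun t => gg p t ^ N * φ t) hsq.ne',
    ← mul_neg, mul_div_cancel_left₀ _ hsq.ne', mul_div_cancel_left₀ _ hsq.ne', Complex.real_smul]

/-- Fourier coefficients of `exp (c e^{iθ})`, indexed with a shift by one. -/
noncomputable def FF (c : ℝ) (m : ℤ) : ℂ :=
  ∫ θ in (-Real.pi)..Real.pi, cexp (-(m * (θ * I))) * cexp (c * cexp (θ * I))

lemma FF_zero (c : ℝ) : FF c 0 = 2 * Real.pi := by
  have h := DiffContOnCl.circleIntegral_sub_inv_smul (f := fun z : ℂ => cexp (c * z)) (c := 0)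
    (w := 0) (R := 1) (Differentiable.diffContOnCl (by fun_prop)) (by simp)
  unfold circleIntegral at h
  have e : ∀ θ : ℝ, deriv (circleMap 0 1) θ • ((circleMap 0 1 θ - 0)⁻¹ •
      cexp (c * circleMap 0 1 θ)) = I * cexp (c * cexp (θ * I)) := by
    intro θ
    have : cexp (θ * I) ≠ 0 := Complex.exp_ne_zero _
    simp only [deriv_circleMap, circleMap, smul_eq_mul]
    simp
    field_simp
  simp only [e] at h
  rw [intervalIntegral.integral_const_mul] at h
  simp only [mul_zero, Complex.exp_zero, smul_eq_mul, mul_one] at h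
  have h' : (∫ θ in (0 : ℝ)..2 * Real.pi, cexp (c * cexp (θ * I))) = 2 * Real.pi := by
    apply mul_left_cancel₀ I_ne_zero; rw [h]; ring
  have hper : Function.Periodic (fun θ : ℝ => cexp (c * cexp (θ * I))) (2 * Real.pi) := by
    intro θ
    simp only
    push_cast
    rw [add_mul, Complex.exp_add, Complex.exp_two_pi_mul_I, mul_one]
  have h2 := hper.intervalIntegral_add_eq (-Real.pi) 0
  rw [zero_add, h'] at h2
  unfold FF
  simp only [Int.cast_zero, zero_mul, neg_zero, Complex.exp_zero, one_mul]
  rw [← h2]; congr 1; ring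

lemma FF_rec (c : ℝ) (m : ℤ) : m * FF c m = c * FF c (m - 1) := by
  have hd : ∀ θ : ℝ, HasDerivAt (fun θ : ℝ => cexp (-(m * (θ * I))) * cexp (c * cexp (θ * I)))
      (-I * (m * (cexp (-(m * (θ * I))) * cexp (c * cexp (θ * I)))) +
        I * (c * (cexp (-((m - 1 : ℤ) * (θ * I))) * cexp (c * cexp (θ * I))))) θ := by
    intro θ
    have h0 : HasDerivAt (fun θ : ℝ => (θ : ℂ) * I) I θ := by
      simpa using (Complex.ofRealCLM.hasDerivAt (x := θ)).mul_const I
    have h1 := ((h0.const_mul (m : ℂ)).neg).cexp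
    have h2 := ((h0.cexp).const_mul (c : ℂ)).cexp
    refine HasDerivAt.congr_deriv (h1.mul h2) ?_
    simp only [Pi.neg_apply]
    have : cexp (-((m - 1 : ℤ) * (θ * I))) = cexp (-(m * (θ * I))) * cexp (θ * I) := by
      rw [← Complex.exp_add]; push_cast; congr 1; ring
    rw [this]; ring
  have hi := intervalIntegral.integral_eq_sub_of_hasDerivAt (a := -Real.pi) (b := Real.pi)
    (fun θ _ => hd θ) (Continuous.intervalIntegrable (by fun_prop) _ _)
  have hb : cexp (-(m * ((Real.pi : ℝ) * I))) * cexp (c * cexp ((Real.pi : ℝ) * I)) -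
    cexp (-(m * ((-Real.pi : ℝ) * I))) * cexp (c * cexp ((-Real.pi : ℝ) * I)) = 0 := by
    have e1 : cexp ((-Real.pi : ℝ) * I) = cexp ((Real.pi : ℝ) * I) := by
      rw [Complex.exp_eq_exp_iff_exists_int]
      exact ⟨-1, by push_cast; ring⟩
    have e2 : cexp (-(m * ((-Real.pi : ℝ) * I))) = cexp (-(m * ((Real.pi : ℝ) * I))) := by
      rw [Complex.exp_eq_exp_iff_exists_int]
      exact ⟨m, by push_cast; ring⟩
    rw [e1, e2, sub_self]
  rw [hb, intervalIntegral.integral_add (Continuous.intervalIntegrable (by fun_prop) _ _)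
    (Continuous.intervalIntegrable (by fun_prop) _ _)] at hi
  simp only [intervalIntegral.integral_const_mul] at hi
  change -I * (m * FF c m) + I * (c * FF c (m - 1)) = 0 at hi
  apply mul_left_cancel₀ I_ne_zero
  linear_combination -hi

lemma FF_nat (c : ℝ) (k : ℕ) : FF c k = 2 * Real.pi * (c ^ k / k.factorial) := by
  induction k with
  | zero => simpa using FF_zero c
  | succ k ih =>
    have h := FF_rec c (k + 1 : ℕ)
    have e : ((k + 1 : ℕ) : ℤ) - 1 = k := by push_cast; ring
    rw [e, ih] at h
    have hk : ((k : ℂ) + 1) ≠ 0 := by exact_mod_cast Nat.succ_ne_zero k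
    have hf : (k.factorial : ℂ) ≠ 0 := by exact_mod_cast k.factorial_ne_zero
    push_cast [Nat.factorial_succ] at h ⊢
    apply mul_left_cancel₀ hk
    rw [h]; field_simp; ring

lemma FF_neg (c : ℝ) (hc : c ≠ 0) : FF c (-1) = 0 := by
  have h := FF_rec c 0
  simp at h
  exact h.resolve_left hc

lemma Lag_int (n : ℕ) (c s : ℝ) (hc : c ≠ 0) :
    ∫ θ in (-Real.pi)..Real.pi, (1 + s * cexp (-(θ * I))) ^ (n + 1) * cexp (c * cexp (θ * I)) *
      cexp (θ * I) = 2 * Real.pi * (Lag n 1 (-(c * s)) * s : ℝ) := by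
  have e : ∀ θ : ℝ, (1 + s * cexp (-(θ * I))) ^ (n + 1) * cexp (c * cexp (θ * I)) *
      cexp (θ * I) = ∑ j ∈ Finset.range (n + 2), ((s : ℂ) ^ j * (n + 1).choose j) *
        (cexp (-(((j : ℤ) - 1 : ℤ) * (θ * I))) * cexp (c * cexp (θ * I))) := by
    intro θ
    rw [add_comm (1 : ℂ), add_pow, Finset.sum_mul, Finset.sum_mul]
    refine Finset.sum_congr rfl fun j _ => ?_
    have : cexp (-(((j : ℤ) - 1 : ℤ) * (θ * I))) = cexp (-(θ * I)) ^ j * cexp (θ * I) := by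
      rw [← Complex.exp_nat_mul, ← Complex.exp_add]; push_cast; congr 1; ring
    rw [this]; ring
  simp only [e]
  rw [intervalIntegral.integral_finsetSum
    (fun j _ => Continuous.intervalIntegrable (by fun_prop) _ _)]
  simp only [intervalIntegral.integral_const_mul]
  change ∑ j ∈ Finset.range (n + 2), ((s : ℂ) ^ j * (n + 1).choose j) * FF c ((j : ℤ) - 1) = _
  rw [Finset.sum_range_succ']
  have z : FF c (((0 : ℕ) : ℤ) - 1) = 0 := by simpa using FF_neg c hc
  rw [z, mul_zero, add_zero]
  unfold Lag
  push_cast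
  rw [Finset.sum_mul, Finset.mul_sum]
  refine Finset.sum_congr rfl fun k hk => ?_
  have hk' : k ≤ n := Nat.lt_succ_iff.mp (Finset.mem_range.mp hk)
  have hch : (n + 1).choose (n - k) = (n + 1).choose (k + 1) := by
    rw [← Nat.choose_symm (show k + 1 ≤ n + 1 by omega)]; congr 1; omega
  rw [hch, add_sub_cancel_right, FF_nat, neg_pow ((c : ℂ) * s), mul_pow]
  have : ((-1 : ℂ) ^ k) * (-1) ^ k = 1 := by rw [← mul_pow]; simp
  linear_combination (-(2 * Real.pi * ((n + 1).choose (k + 1) : ℂ) * (c ^ k * s ^ k)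
    / k.factorial * s)) * this

lemma Lag_lim (p s r : ℝ) (hp : 0 < p) (hp1 : p < 1) (hs : 0 < s) (hr : 0 < r)
    (hr2 : r ^ 2 = 1 - p) (hrs : r ^ 2 * s = p) :
    Tendsto (fun K : ℕ => √((K + 2 : ℕ) : ℝ) * r ^ (2 * (K + 2)) *
      Real.exp (-((K + 2 : ℕ) * p)) * Lag (K + 1) 1 (-((K + 2 : ℕ) * p * s))) atTop
      (𝓝 (√(Real.pi / (p * (2 - p) / 2)) / (2 * Real.pi * s))) ∧
    Tendsto (fun K : ℕ => √((K + 2 : ℕ) : ℝ) * r ^ (2 * (K + 2)) *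
      Real.exp (-((K + 2 : ℕ) * p)) * Lag K 1 (-((K + 2 : ℕ) * p * s))) atTop
      (𝓝 (r ^ 2 * (√(Real.pi / (p * (2 - p) / 2)) / (2 * Real.pi * s)))) := by
  have hpi : (Real.pi : ℂ) ≠ 0 := by exact_mod_cast Real.pi_ne_zero
  have hsC : (s : ℂ) ≠ 0 := by exact_mod_cast hs.ne'
  have hr2C : (r : ℂ) ^ 2 = 1 - p := by exact_mod_cast hr2
  have hrsC : (r : ℂ) ^ 2 * s = p := by exact_mod_cast hrs
  have hbase : ∀ θ : ℝ, (r : ℂ) ^ 2 * (1 + s * cexp (-(θ * I))) =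
      1 - p + p * cexp (-(θ * I)) := by
    intro θ; rw [mul_add, ← mul_assoc, hrsC, hr2C, mul_one]
  have hexp : ∀ (N : ℕ) (θ : ℝ), cexp (-(N * p)) * cexp ((N * p : ℝ) * cexp (θ * I)) =
      cexp (p * (cexp (θ * I) - 1)) ^ N := by
    intro N θ
    rw [← Complex.exp_add, ← Complex.exp_nat_mul]; push_cast; congr 1; ring
  constructor
  · have h := (local_limit p hp hp1 (fun θ => cexp (θ * I)) (by fun_prop)).comp
      (tendsto_add_atTop_nat 2)
    have h2 := h.div_const (2 * Real.pi * s : ℂ)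
    rw [← tendsto_ofReal_iff]
    convert h2 using 1
    · ext K
      simp only [Function.comp]
      have hL := Lag_int (K + 1) ((K + 2 : ℕ) * p) s (by positivity)
      rw [eq_div_iff (by simp [hpi, hsC])]
      push_cast
      push_cast at hL
      have hint : (∫ θ in (-Real.pi)..Real.pi, gg p θ ^ (K + 2) * cexp (θ * I)) =
          r ^ (2 * (K + 2)) * cexp (-((K + 2 : ℕ) * p)) *
          (2 * Real.pi * (Lag (K + 1) 1 (-((K + 2 : ℕ) * p * s)) * s : ℝ)) := by
        rw [← Lag_int (K + 1) ((K + 2 : ℕ) * p) s (by positivity),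
          ← intervalIntegral.integral_const_mul]
        congr 1; ext θ
        unfold gg
        rw [mul_pow, ← hexp, ← hbase, mul_pow, ← pow_mul]; ring
      rw [hint]; push_cast; ring
    · push_cast; simp
  · have h := (local_limit p hp hp1 (fun θ => cexp (p * (cexp (θ * I) - 1)) * cexp (θ * I))
      (by fun_prop)).comp (tendsto_add_atTop_nat 1)
    have hq : Tendsto (fun K : ℕ => (√((K + 2 : ℕ) : ℝ) / √((K + 1 : ℕ) : ℝ))) atTop (𝓝 1) := by
      have h1 : Tendsto (fun K : ℕ => 1 + 1 / ((K : ℝ) + 1)) atTop (𝓝 (1 + 0)) :=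
        tendsto_one_div_add_atTop_nhds_zero_nat.const_add 1
      have h2 := (Real.continuous_sqrt.tendsto _).comp h1
      simp only [add_zero, Real.sqrt_one] at h2
      refine h2.congr fun K => ?_
      simp only [Function.comp]
      rw [← Real.sqrt_div (Nat.cast_nonneg _)]
      congr 1; push_cast
      have : (K : ℝ) + 1 ≠ 0 := by positivity
      field_simp; ring
    have hqC := tendsto_ofReal_iff.mpr hq
    have h2 := ((hqC.mul h).div_const (2 * Real.pi * s : ℂ)).const_mul ((r : ℂ) ^ 2)
    rw [← tendsto_ofReal_iff]
    convert h2 using 1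
    · ext K
      simp only [Function.comp]
      have hint : (∫ θ in (-Real.pi)..Real.pi, gg p θ ^ (K + 1) *
          (cexp (p * (cexp (θ * I) - 1)) * cexp (θ * I))) =
          r ^ (2 * (K + 1)) * cexp (-((K + 2 : ℕ) * p)) *
          (2 * Real.pi * (Lag K 1 (-((K + 2 : ℕ) * p * s)) * s : ℝ)) := by
        rw [← Lag_int K ((K + 2 : ℕ) * p) s (by positivity),
          ← intervalIntegral.integral_const_mul]
        congr 1; ext θ
        have hx := hexp (K + 2) θ
        rw [pow_succ] at hx
        unfold gg
        rw [mul_pow, ← hbase, mul_pow, ← pow_mul]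
        linear_combination (-(r : ℂ) ^ (2 * (K + 1)) * (1 + s * cexp (-(θ * I))) ^ (K + 1) *
          cexp (θ * I)) * hx
      rw [hint]
      have hK : ((√((K + 1 : ℕ) : ℝ) : ℝ) : ℂ) ≠ 0 := by
        have : 0 < √((K + 1 : ℕ) : ℝ) := Real.sqrt_pos.mpr (by positivity)
        exact_mod_cast this.ne'
      push_cast at hK ⊢
      field_simp
      try ring
    · push_cast; simp

/-- For fixed `γ > 0` and `Y ∈ (0, γ)` with `r_*(Y)(γ−Y) ≠ 1`
(equivalently `Ψ_γ(Y) ≠ 0`), the mean density of imaginary parts satisfies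
`lim_{N→∞} √N · e^{NΦ_γ(Y)} · ρ_N^γ(Y) / Ψ_γ(Y) = 1`. -/
theorem large_deviation_asymptotics_fixed_Y (γ Y : ℝ) (hγ : 0 < γ) (hY : 0 < Y)
    (hYγ : Y < γ) (hr : rstar Y * (γ - Y) ≠ 1) :
    Filter.Tendsto
      (fun N : ℕ =>
        Real.sqrt N * Real.exp ((N : ℝ) * Phi γ Y) * rhoIm N γ Y / Psi γ Y)
      Filter.atTop (nhds 1) := by
  have hS0 : 0 < Y ^ 2 + 4 := by positivity
  have hS : √(Y ^ 2 + 4) ^ 2 = Y ^ 2 + 4 := Real.sq_sqrt hS0.le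
  have hSY : Y < √(Y ^ 2 + 4) := Real.lt_sqrt_of_sq_lt (by linarith)
  have hSeq : √(Y ^ 2 + 4) = 2 * rstar Y + Y := by unfold rstar; ring
  have hr0 : 0 < rstar Y := by unfold rstar; linarith
  have hrq : rstar Y ^ 2 = 1 - Y * rstar Y := by unfold rstar; nlinarith
  have hPhi : Phi γ Y = Y * (γ - Y) - Real.log ((γ - Y) / γ) - Y * rstar Y
    + 2 * Real.log (rstar Y) := rfl
  have hPsi : Psi γ Y = (1 / Real.sqrt (2 * Real.pi)) * (γ / (γ - Y) ^ 2) *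
    (1 - rstar Y * (γ - Y)) ^ 2 / (Y ^ ((3 : ℝ) / 2) * (Y ^ 2 + 4) ^ ((1 : ℝ) / 4)) := rfl
  generalize rstar Y = r at *
  obtain ⟨u, rfl⟩ : ∃ u, γ = u + Y := ⟨γ - Y, by ring⟩
  have hu : 0 < u := by linarith
  rw [add_sub_cancel_right] at hr hPhi hPsi
  have hp : 0 < Y * r := by positivity
  have hp1 : Y * r < 1 := by nlinarith [sq_pos_of_pos hr0]
  obtain ⟨hA, hB⟩ := Lag_lim (Y * r) (Y / r) r hp hp1 (by positivity) hr0 hrq (by field_simp)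
  set κ := √(Real.pi / (Y * r * (2 - Y * r) / 2)) / (2 * Real.pi * (Y / r)) with hκ
  have hκv : κ = 1 / √(2 * Real.pi) / (Y ^ ((3 : ℝ) / 2) * (Y ^ 2 + 4) ^ ((1 : ℝ) / 4)) := by
    have e1 : (Y : ℝ) ^ ((3 : ℝ) / 2) = Y * √Y := by
      rw [show (3 : ℝ) / 2 = 1 + 1 / 2 by norm_num, Real.rpow_add hY, Real.rpow_one,
        Real.sqrt_eq_rpow]
    have e2 : (Y ^ 2 + 4) ^ ((1 : ℝ) / 4) = √(√(Y ^ 2 + 4)) := by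
      rw [Real.sqrt_eq_rpow, Real.sqrt_eq_rpow, ← Real.rpow_mul hS0.le]; norm_num
    have hQ : 0 < √(Y ^ 2 + 4) := Real.sqrt_pos.mpr hS0
    have e3 : Real.pi / (Y * r * (2 - Y * r) / 2) =
        (2 * Real.pi) ^ 2 / ((2 * Real.pi) * (r ^ 2 * (Y * √(Y ^ 2 + 4)))) := by
      have h4 : Y * r * (2 - Y * r) = r ^ 2 * (Y * √(Y ^ 2 + 4)) := by
        rw [hSeq]; linear_combination (-(2 * Y * r)) * hrq
      rw [h4]
      have := Real.pi_pos
      field_simp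
    have e4 : √(Real.pi / (Y * r * (2 - Y * r) / 2)) =
        2 * Real.pi / (√(2 * Real.pi) * (r * (√Y * √(√(Y ^ 2 + 4))))) := by
      have := Real.pi_pos
      rw [e3, Real.sqrt_div (by positivity), Real.sqrt_sq (by positivity),
        Real.sqrt_mul (show (0 : ℝ) ≤ 2 * Real.pi by positivity) (r ^ 2 * _),
        Real.sqrt_mul (sq_nonneg r), Real.sqrt_sq hr0.le,
        Real.sqrt_mul hY.le]
    rw [hκ, e4, e1, e2]
    have := Real.pi_pos
    have hYs : 0 < √Y := Real.sqrt_pos.mpr hY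
    have hQs : 0 < √(√(Y ^ 2 + 4)) := Real.sqrt_pos.mpr hQ
    have hps : 0 < √(2 * Real.pi) := Real.sqrt_pos.mpr (by positivity)
    field_simp
  have hPsi' : Psi (u + Y) Y = (u + Y) / u ^ 2 * (1 - r * u) ^ 2 * κ := by
    rw [hPsi, hκv]; ring
  have hκ0 : κ ≠ 0 := by
    have := Real.pi_pos
    have h2 : 0 < 2 - Y * r := by linarith
    have : 0 < κ := by rw [hκ]; positivity
    exact this.ne'
  have hru : 1 - r * u ≠ 0 := fun h => hr (by linarith)
  have hΨ0 : Psi (u + Y) Y ≠ 0 := by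
    rw [hPsi']; positivity
  rw [← tendsto_add_atTop_iff_nat 2]
  have hq : Tendsto (fun K : ℕ => (((K + 2 : ℕ) : ℝ) - 1) / ((K + 2 : ℕ) : ℝ)) atTop (𝓝 1) := by
    have h1 : Tendsto (fun K : ℕ => 1 - 1 / (((K + 1 : ℕ) : ℝ) + 1)) atTop (𝓝 (1 - 0)) :=
      (tendsto_one_div_add_atTop_nhds_zero_nat.comp (tendsto_add_atTop_nat 1)).const_sub 1
    rw [sub_zero] at h1
    refine h1.congr fun K => ?_
    push_cast
    have : (K : ℝ) + 1 + 1 ≠ 0 := by positivity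
    have : (K : ℝ) + 2 ≠ 0 := by positivity
    field_simp
    ring
  have hfin := (((((hq.mul_const (3 * Y - 2 * (u + Y))).mul hA).add
    (hB.const_mul (2 * u + Y * u ^ 2))).const_mul ((u + Y) / u ^ 2 / Y)).div_const
      (Psi (u + Y) Y))
  convert hfin using 1
  · ext K
    congr 1
    have hexp : Real.exp (((K + 2 : ℕ) : ℝ) * Phi (u + Y) Y) =
        Real.exp (((K + 2 : ℕ) : ℝ) * Y * u) * ((u + Y) / u) ^ (K + 2) *
          Real.exp (-(((K + 2 : ℕ) : ℝ) * (Y * r))) * r ^ (2 * (K + 2)) := by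
      have e1 : ((u + Y) / u) ^ (K + 2) =
          Real.exp (((K + 2 : ℕ) : ℝ) * -Real.log (u / (u + Y))) := by
        rw [Real.exp_nat_mul, ← Real.log_inv, Real.exp_log (by positivity), inv_div]
      have e2 : r ^ (2 * (K + 2)) = Real.exp (((K + 2 : ℕ) : ℝ) * (2 * Real.log r)) := by
        rw [Real.exp_nat_mul, two_mul (Real.log r), Real.exp_add, Real.exp_log hr0, pow_mul, sq]
      rw [e1, e2, ← Real.exp_add, ← Real.exp_add, ← Real.exp_add, hPhi]
      congr 1; ring
    rw [hexp]
    unfold rhoIm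
    have ex : -((K + 2 : ℕ) : ℝ) * Y ^ 2 = -(((K + 2 : ℕ) : ℝ) * (Y * r) * (Y / r)) := by
      field_simp
    have eb : 1 - Y / (u + Y) = u / (u + Y) := by field_simp; ring
    have es1 : K + 2 - 1 = K + 1 := rfl
    have es2 : K + 2 - 2 = K := rfl
    rw [ex, add_sub_cancel_right, eb, es1, es2]
    have ee : Real.exp (((K + 2 : ℕ) : ℝ) * Y * u) * Real.exp (-((K + 2 : ℕ) : ℝ) * Y * u) = 1 := by
      rw [← Real.exp_add, Real.exp_eq_one_iff]; ring
    have ep : ((u + Y) / u) ^ (K + 2) * (u / (u + Y)) ^ K = ((u + Y) / u) ^ 2 := by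
      rw [pow_add, mul_right_comm, ← mul_pow]
      have : (u + Y) / u * (u / (u + Y)) = 1 := by field_simp
      rw [this]; simp
    have e3 : 2 * (u + Y) - 2 * Y + Y * u ^ 2 = 2 * u + Y * u ^ 2 := by ring
    rw [e3]
    generalize Lag (K + 1) 1 (-(((K + 2 : ℕ) : ℝ) * (Y * r) * (Y / r))) = LA
    generalize Lag K 1 (-(((K + 2 : ℕ) : ℝ) * (Y * r) * (Y / r))) = LB
    generalize Real.exp (-(((K + 2 : ℕ) : ℝ) * (Y * r))) = X
    generalize r ^ (2 * (K + 2)) = R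
    generalize (((K + 2 : ℕ) : ℝ) - 1) / ((K + 2 : ℕ) : ℝ) = q
    generalize √((K + 2 : ℕ) : ℝ) = Q
    generalize Real.exp (((K + 2 : ℕ) : ℝ) * Y * u) = E1 at *
    generalize Real.exp (-((K + 2 : ℕ) : ℝ) * Y * u) = E2 at *
    generalize ((u + Y) / u) ^ (K + 2) = P1 at *
    generalize (u / (u + Y)) ^ K = P2 at *
    calc _ = (E1 * E2) * (P1 * P2) * (1 / (Y * (u + Y))) * (Q * R * X) *
          (q * (3 * Y - 2 * (u + Y)) * LA + (2 * u + Y * u ^ 2) * LB) := by ring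
      _ = _ := by
        rw [ee, ep]; field_simp
  · congr 1
    rw [eq_div_iff hΨ0, hPsi']
    have : Y * (1 - r * u) ^ 2 = (3 * Y - 2 * (u + Y)) + (2 * u + Y * u ^ 2) * r ^ 2 := by
      linear_combination (-2 * u) * hrq
    have h5 : (1 - r * u) ^ 2 = ((3 * Y - 2 * (u + Y)) + (2 * u + Y * u ^ 2) * r ^ 2) / Y := by
      rw [← this]; field_simp
    rw [h5]
    ring
end

section
/- Fix α ∈ ℝ and m > 0, and set γ_N = 1 + α·N^{−1/3} and Y_N = m·N^{−1/3}. Then lim_{N→∞} N^{2/3} · ρ_N^{γ_N}(Y_N) = (1/(2√π)) · (3/(2m) + (3m/2 − α)²) · m^{−3/2} · e^{−m(α − m/2)²}. -/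
open Filter Topology

noncomputable def WW (N : ℕ) (x : ℝ) (k : ℕ) : ℝ := (N.choose (k+1) : ℝ) * x^k / (k.factorial : ℝ)

lemma lag_eq (N : ℕ) (hN : 2 ≤ N) (x : ℝ) : Lag (N-1) 1 (-x) = ∑ k ∈ Finset.range N, WW N x k := by
  obtain ⟨n, rfl⟩ : ∃ n, N = n + 1 := ⟨N-1, by omega⟩
  simp only [Lag, Nat.add_sub_cancel]
  refine Finset.sum_congr rfl fun k hk => ?_
  have hk' : k ≤ n := by have := Finset.mem_range.1 hk; omega
  have : (n+1).choose (n-k) = (n+1).choose (k+1) := by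
    rw [← Nat.choose_symm (show k+1 ≤ n+1 by omega)]; congr 1; omega
  rw [WW, this, neg_pow x k]
  have h1 : ((-1:ℝ)^k) * (-1)^k = 1 := by rw [← mul_pow]; simp
  linear_combination (((n+1).choose (k+1) : ℝ) * x^k / (k.factorial : ℝ)) * h1

lemma lag_eq2 (N : ℕ) (hN : 2 ≤ N) (x : ℝ) :
    (N:ℝ) * Lag (N-2) 1 (-x) = ∑ k ∈ Finset.range N, WW N x k * ((N:ℝ) - 1 - k) := by
  obtain ⟨n, rfl⟩ : ∃ n, N = n + 2 := ⟨N-2, by omega⟩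
  have := lag_eq (n+2-1) 
  simp only [Lag, Nat.add_sub_cancel]
  rw [Finset.sum_range_succ _ (n+1), Finset.mul_sum]
  have hz : ((n+2:ℕ):ℝ) - 1 - ((n+1:ℕ):ℝ) = 0 := by push_cast; ring
  rw [hz, mul_zero, add_zero]
  refine Finset.sum_congr rfl fun k hk => ?_
  have hk' : k ≤ n := by have := Finset.mem_range.1 hk; omega
  have h2 : (n+1).choose (n-k) = (n+1).choose (k+1) := by
    rw [← Nat.choose_symm (show k+1 ≤ n+1 by omega)]; congr 1; omega
  have h3 := Nat.choose_mul_succ_eq (n+1) (k+1)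
  have h4 : ((n+1).choose (k+1) : ℝ) * (n+2) = ((n+2).choose (k+1) : ℝ) * ((n:ℝ)+1-k) := by
    have : n + 1 + 1 - (k+1) = n + 1 - k := by omega
    rw [this] at h3
    have h5 : ((n+1-k : ℕ) : ℝ) = (n:ℝ)+1-k := by rw [Nat.cast_sub (by omega)]; push_cast; ring
    rw [← h5]; exact_mod_cast h3
  rw [WW, h2, neg_pow x k]
  have h1 : ((-1:ℝ)^k) * (-1)^k = 1 := by rw [← mul_pow]; simp
  push_cast
  linear_combination (((n+2:ℝ)) * ((n+1).choose (k+1) : ℝ) * x^k / (k.factorial : ℝ)) * h1 + x^k / (k.factorial : ℝ) * h4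

lemma ww_id (N : ℕ) (hN : 2 ≤ N) (x : ℝ) (f : ℝ → ℝ) :
    ∑ k ∈ Finset.range N, WW N x k * (f k * (k * (k+1))) =
      x * ∑ k ∈ Finset.range N, WW N x k * (f (k+1) * ((N:ℝ) - 1 - k)) := by
  obtain ⟨n, rfl⟩ : ∃ n, N = n + 1 := ⟨N-1, by omega⟩
  rw [Finset.sum_range_succ', Finset.sum_range_succ _ n]
  have hz : ((n+1:ℕ):ℝ) - 1 - ((n:ℕ):ℝ) = 0 := by push_cast; ring
  rw [hz]
  simp only [Nat.cast_zero, zero_mul, mul_zero, add_zero]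
  rw [Finset.mul_sum]
  refine Finset.sum_congr rfl fun k hk => ?_
  have hk' : k < n := Finset.mem_range.1 hk
  have h3 := Nat.choose_succ_right_eq (n+1) (k+1)
  have h4 : ((n+1).choose (k+1+1) : ℝ) * (k+2) = ((n+1).choose (k+1) : ℝ) * ((n:ℝ)-k) := by
    have : n + 1 - (k+1) = n - k := by omega
    rw [this] at h3
    have h5 : ((n-k : ℕ) : ℝ) = (n:ℝ)-k := by rw [Nat.cast_sub (by omega)]
    rw [← h5]; exact_mod_cast h3
  rw [WW, WW, Nat.factorial_succ]
  have : (k.factorial : ℝ) ≠ 0 := by positivity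
  have : (k:ℝ) + 1 ≠ 0 := by positivity
  push_cast
  field_simp
  rw [pow_succ]
  linear_combination (x^k * x * f (k+1)) * h4

lemma ww_nonneg (N : ℕ) (x : ℝ) (hx : 0 ≤ x) (k : ℕ) : 0 ≤ WW N x k := by
  unfold WW; positivity

lemma ww_pos (N : ℕ) (hN : 2 ≤ N) (x : ℝ) (hx : 0 ≤ x) : 0 < ∑ k ∈ Finset.range N, WW N x k := by
  refine Finset.sum_pos' (fun k _ => ww_nonneg N x hx k) ⟨0, Finset.mem_range.2 (by omega), ?_⟩
  simp [WW]; omega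

/-- moment bounds; `S_j = Σ W (k-p)^j` -/
lemma moments (N : ℕ) (hN : 2 ≤ N) (x p q : ℝ) (hx : 0 ≤ x) (hp : 0 ≤ p) (hq : q = p + 1 + x) (hpq : p * q = x * (N - 1)) :
    ∃ d1 d2 d3 d4 : ℝ, (N:ℝ) * Lag (N-2) 1 (-x) = (N - 1 - p - d1) * Lag (N-1) 1 (-x) ∧
      d2 + (p + q) * d1 = 0 ∧
      d3 + (p+q) * d2 = x * (N - 1 - p - d1) ∧ 
      0 ≤ d2 ∧ q * d2 ≤ x * N ∧ 0 ≤ d4 ∧ q * d4 ≤ x * N * (5 * d2 + 3) ∧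
      (∀ h : ℝ, 0 < h → 2 * |d3| ≤ d2 / h + d4 * h) := by
  set S := ∑ k ∈ Finset.range N, WW N x k with hS
  have hSpos : 0 < S := ww_pos N hN x hx
  obtain ⟨E, hE⟩ : ∃ E : (ℝ → ℝ) → ℝ, ∀ f, E f = (∑ k ∈ Finset.range N, WW N x k * f k) / S := ⟨_, fun _ => rfl⟩
  have Eadd : ∀ f g, E (fun k => f k + g k) = E f + E g := by
    intro f g; simp only [hE, mul_add, Finset.sum_add_distrib, add_div]
  have Emul : ∀ c f, E (fun k => c * f k) = c * E f := by
    intro c f; simp only [hE]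
    rw [← mul_div_assoc, Finset.mul_sum]; congr 1
    exact Finset.sum_congr rfl fun k _ => by ring
  have E1 : E (fun _ => 1) = 1 := by simp only [hE, mul_one]; exact div_self hSpos.ne'
  have Ec : ∀ c, E (fun _ => c) = c := by
    intro c; have := Emul c (fun _ => 1); simpa [E1] using this
  have Emono : ∀ f g : ℝ → ℝ, (∀ k : ℕ, k < N → f k ≤ g k) → E f ≤ E g := by
    intro f g hfg
    simp only [hE]
    gcongr with k hk
    · exact ww_nonneg N x hx k
    · exact hfg k (Finset.mem_range.1 hk)
  have Eid : ∀ f : ℝ → ℝ, E (fun k => f k * (k * (k+1))) = x * E (fun k => f (k+1) * ((N:ℝ) - 1 - k)) := by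
    intro f; simp only [hE]; rw [← mul_div_assoc, ww_id N hN x f]
  have Eg : ∀ f : ℝ → ℝ, E (fun k => f k * ((k - p) * (k + q))) = x * E (fun k => (f (k+1) - f k) * ((N:ℝ) - 1 - k)) := by
    intro f
    have h1 : (fun k : ℝ => f k * ((k - p) * (k + q))) = fun k => f k * (k * (k+1)) + (-x) * (f k * ((N:ℝ) - 1 - k)) := by
      funext k; rw [hq] at hpq ⊢; linear_combination (-f k) * hpq
    have h2 : (fun k : ℝ => (f (k+1) - f k) * ((N:ℝ) - 1 - k)) = fun k => f (k+1) * ((N:ℝ) - 1 - k) + (-1) * (f k * ((N:ℝ) - 1 - k)) := by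
      funext k; ring
    rw [h1, h2, Eadd, Eadd, Emul, Emul, Eid]; ring
  have hk1 : ∀ k : ℕ, k < N → 0 ≤ (N:ℝ) - 1 - k ∧ (N:ℝ) - 1 - k ≤ N := by
    intro k hk
    have : (k:ℝ) + 1 ≤ N := by exact_mod_cast hk
    have : (0:ℝ) ≤ k := by positivity
    constructor <;> linarith
  refine ⟨E (fun k => k - p), E (fun k => (k-p)^2), E (fun k => (k-p)^3), E (fun k => (k-p)^4), ?_, ?_, ?_, ?_, ?_, ?_, ?_, ?_⟩
  · rw [lag_eq2 N hN, lag_eq N hN, ← hS]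
    have h1 : E (fun k => (N:ℝ) - 1 - k) = N - 1 - p - E (fun k => k - p) := by
      have : (fun k : ℝ => (N:ℝ) - 1 - k) = fun k => (N - 1 - p) + (-1) * (k - p) := by funext k; ring
      rw [this, Eadd (fun _ => _), Emul, Ec]; ring
    rw [← h1]
    simp only [hE]; field_simp
  · have h := Eg (fun _ => 1)
    have h1 : (fun k : ℝ => 1 * ((k - p) * (k + q))) = fun k => (k-p)^2 + (p+q) * (k-p) := by funext k; ring
    simp only [h1] at h
    rw [Eadd, Emul] at h
    simpa [Ec] using h
  · have h := Eg (fun k => k - p)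
    have h1 : (fun k : ℝ => (k-p) * ((k - p) * (k + q))) = fun k => (k-p)^3 + (p+q) * (k-p)^2 := by funext k; ring
    have h2 : (fun k : ℝ => (k + 1 - p - (k - p)) * ((N:ℝ) - 1 - k)) = fun k => (N - 1 - p) + (-1) * (k - p) := by funext k; ring
    rw [h1, h2, Eadd, Emul, Eadd (fun _ => _), Emul, Ec] at h
    rw [h]; ring
  · rw [← Ec 0]; exact Emono _ _ fun k _ => by positivity
  · have h := Eg (fun k => k - p)
    rw [← Emul]
    calc E (fun k => q * (k-p)^2) ≤ E (fun k => (k - p) * ((k-p) * (k+q))) := by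
          refine Emono _ _ fun k _ => ?_
          have : 0 ≤ (k:ℝ) * ((k:ℝ)-p)^2 := by positivity
          nlinarith
      _ = x * E (fun k => (k + 1 - p - (k - p)) * ((N:ℝ) - 1 - k)) := h
      _ ≤ x * E (fun k => (N:ℝ)) := by
          gcongr
          refine Emono _ _ fun k hk => ?_
          have := hk1 k hk
          nlinarith
      _ = x * N := by rw [Ec]
  · rw [← Ec 0]; exact Emono _ _ fun k _ => by positivity
  · have h := Eg (fun k => (k - p)^3)
    rw [← Emul]
    calc E (fun k => q * (k-p)^4) ≤ E (fun k => (k - p)^3 * ((k-p) * (k+q))) := by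
          refine Emono _ _ fun k _ => ?_
          have : 0 ≤ (k:ℝ) * ((k:ℝ)-p)^4 := by positivity
          nlinarith
      _ = x * E (fun k => ((k + 1 - p)^3 - (k - p)^3) * ((N:ℝ) - 1 - k)) := h
      _ ≤ x * E (fun k => (N:ℝ) * (5 * (k-p)^2 + 3)) := by
          gcongr
          refine Emono _ _ fun k hk => ?_
          have h1 := hk1 k hk
          have h2 : ((k:ℝ) + 1 - p)^3 - (k - p)^3 ≤ 5 * (k-p)^2 + 3 := by nlinarith [sq_nonneg ((k:ℝ)-p-1)]
          have h3 : 0 ≤ 5 * ((k:ℝ)-p)^2 + 3 := by positivity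
          calc _ ≤ (5 * ((k:ℝ)-p)^2 + 3) * ((N:ℝ) - 1 - k) := by gcongr; exact h1.1
            _ ≤ (5 * ((k:ℝ)-p)^2 + 3) * N := by gcongr; exact h1.2
            _ = _ := by ring
      _ = _ := by rw [Emul, Eadd, Emul, Ec]; ring
  · intro h hh
    have key : ∀ u : ℝ, 2 * |u^3| ≤ u^2/h + u^4 * h := by
      intro u
      have h2 : 0 ≤ u^2 * (1 - |u| * h)^2 / h := by positivity
      have h3 : |u^3| = u^2 * |u| := by rw [abs_pow, pow_succ, sq_abs]
      have h4 : u^4 = u^2 * |u|^2 := by rw [sq_abs]; ring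
      rw [h3, h4]
      have : u^2 * (1 - |u| * h)^2 / h = u^2/h + u^2*|u|^2 * h - 2 * (u^2*|u|) := by field_simp; ring
      linarith
    have : |E (fun k => (k-p)^3)| ≤ (E (fun k => (k-p)^2) / h + E (fun k => (k-p)^4) * h)/2 := by
      have e : (E (fun k => (k-p)^2) / h + E (fun k => (k-p)^4) * h)/2 = E (fun k => (1/(2*h)) * (k-p)^2 + (h/2) * (k-p)^4) := by
        rw [Eadd, Emul, Emul]; field_simp
      rw [abs_le]
      constructor
      · rw [e, neg_eq_neg_one_mul, ← Emul]
        refine Emono _ _ fun k _ => ?_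
        have h1 := key (k-p)
        have h2 := neg_abs_le (((k:ℝ)-p)^3)
        have e2 : (1/(2*h)) * ((k:ℝ)-p)^2 + (h/2) * (k-p)^4 = (((k:ℝ)-p)^2/h + (k-p)^4 * h)/2 := by field_simp
        rw [e2]; linarith
      · rw [e]
        refine Emono _ _ fun k _ => ?_
        have h1 := key (k-p)
        have h2 := le_abs_self (((k:ℝ)-p)^3)
        have e2 : (1/(2*h)) * ((k:ℝ)-p)^2 + (h/2) * (k-p)^4 = (((k:ℝ)-p)^2/h + (k-p)^4 * h)/2 := by field_simp
        rw [e2]; linarith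
    linarith

set_option maxHeartbeats 1600000 in
lemma bracket_lim (α m : ℝ) (hm : 0 < m) (h : ℕ → ℝ) (hh : Tendsto h atTop (𝓝[>] 0))
    (hN : ∀ᶠ N : ℕ in atTop, (N:ℝ) * h N ^ 3 = 1) :
    Tendsto (fun N : ℕ => ((((N : ℝ) - 1) / (N : ℝ) * (3 * (m * h N) - 2 * (1 + α * h N)) * Lag (N - 1) 1 (-(N * (m * h N)^2))
      + (2 * (1 + α * h N) - 2 * (m * h N) + (m * h N) * ((1 + α * h N) - (m * h N)) ^ 2) * Lag (N - 2) 1 (-(N * (m * h N)^2)))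
        / Lag (N - 1) 1 (-(N * (m * h N)^2))) / h N ^ 3) atTop (𝓝 (3/2 + m * (3 * m / 2 - α)^2)) := by
  have h0 : Tendsto h atTop (𝓝 0) := hh.mono_right nhdsWithin_le_nhds
  have hpos : ∀ᶠ N in atTop, 0 < h N := hh.eventually self_mem_nhdsWithin
  obtain ⟨R, hR⟩ : ∃ R : ℝ → ℝ, R = fun t => Real.sqrt ((t - m^2)^2 * t^2 + 4 * m^2) := ⟨_, rfl⟩
  obtain ⟨P, hP⟩ : ∃ P : ℝ → ℝ, P = fun t => (R t - t^2 - m^2 * t)/2 := ⟨_, rfl⟩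
  obtain ⟨Q, hQ⟩ : ∃ Q : ℝ → ℝ, Q = fun t => (R t + t^2 + m^2 * t)/2 := ⟨_, rfl⟩
  obtain ⟨T, hT⟩ : ∃ T : ℝ → ℝ, T = fun t => ((t-m^2)^2/(R t + 2 * m) - 1)/2 := ⟨_, rfl⟩
  have R0 : R 0 = 2 * m := by
    rw [hR]; simp only; rw [show ((0:ℝ) - m^2)^2 * 0^2 + 4 * m^2 = (2*m)^2 by ring]
    exact Real.sqrt_sq (by positivity)
  have Rpos : ∀ t, 0 ≤ R t := fun t => by rw [hR]; exact Real.sqrt_nonneg _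
  have Rsq : ∀ t, R t ^ 2 = (t - m^2)^2 * t^2 + 4 * m^2 := fun t => by
    rw [hR]; exact Real.sq_sqrt (by positivity)
  have Rc : Continuous R := by rw [hR]; fun_prop
  have Pc : Continuous P := by rw [hP]; fun_prop
  have Qc : Continuous Q := by rw [hQ]; fun_prop
  have Tc : Continuous T := by
    rw [hT]
    refine Continuous.div_const (Continuous.sub (Continuous.div (by fun_prop) (by fun_prop) fun t => ?_) (by fun_prop)) _
    have := Rpos t; positivity
  have P0 : P 0 = m := by rw [hP]; simp [R0]
  have Q0 : Q 0 = m := by rw [hQ]; simp [R0]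
  have T0 : T 0 = m^3/8 - 1/2 := by rw [hT]; simp only [R0]; field_simp; ring
  have PT : ∀ t, P t = m - m^2 * t/2 + t^2 * T t := by
    intro t; have h1 := Rsq t
    have h2 : R t + 2 * m ≠ 0 := by have := Rpos t; positivity
    have h3 : t^2 * ((t-m^2)^2/(R t + 2 * m)) = R t - 2 * m := by
      rw [← mul_div_assoc, div_eq_iff h2]; linear_combination -h1
    rw [hP, hT]; simp only
    linear_combination (-1/2) * h3
  have Plim : Tendsto (fun N => P (h N)) atTop (𝓝 m) := by rw [← P0]; exact (Pc.tendsto 0).comp h0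
  have Qlim : Tendsto (fun N => Q (h N)) atTop (𝓝 m) := by rw [← Q0]; exact (Qc.tendsto 0).comp h0
  have Tlim : Tendsto (fun N => T (h N)) atTop (𝓝 (m^3/8-1/2)) := by rw [← T0]; exact (Tc.tendsto 0).comp h0
  have good : ∀ᶠ N : ℕ in atTop, 2 ≤ N ∧ 0 < h N ∧ h N < 1 ∧ (N:ℝ) * h N ^ 3 = 1 ∧ 0 < P (h N) ∧ m/2 < Q (h N) := by
    filter_upwards [eventually_ge_atTop 2, hpos, h0.eventually (gt_mem_nhds one_pos), hN,
      Plim.eventually (lt_mem_nhds hm), Qlim.eventually (lt_mem_nhds (half_lt_self hm))] with N a b c d e f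
    exact ⟨a, b, c, d, e, f⟩
  have main : ∀ N : ℕ, ∃ d1 D2 D3 : ℝ, (2 ≤ N ∧ 0 < h N ∧ h N < 1 ∧ (N:ℝ) * h N ^ 3 = 1 ∧ 0 < P (h N) ∧ m/2 < Q (h N)) →
      Lag (N-2) 1 (-(N * (m * h N)^2)) = (1 - h N^3 - h N * P (h N) - h N ^3 * d1) * Lag (N-1) 1 (-(N * (m * h N)^2)) ∧
      D2 + (P (h N) + Q (h N)) * d1 = 0 ∧ D3 + (P (h N) + Q (h N)) * D2 = m^2 * (1 - h N^3 - h N * P (h N) - h N ^3 * d1) ∧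
      0 ≤ D2 ∧ D2 ≤ 2 * m ∧ |D3| ≤ h N * (2 * m + 2 * m * (10 * m + 3)) := by
    intro N
    by_cases hg : (2 ≤ N ∧ 0 < h N ∧ h N < 1 ∧ (N:ℝ) * h N ^ 3 = 1 ∧ 0 < P (h N) ∧ m/2 < Q (h N))
    swap
    · exact ⟨0, 0, 0, fun hc => absurd hc hg⟩
    obtain ⟨h2, ht, ht1, hNt, hPp, hQp⟩ := hg
    generalize htt : h N = t at *
    have hNpos : (0:ℝ) < N := by positivity
    have hNe : (N:ℝ) = 1/t^3 := by field_simp; exact hNt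
    have hx : (N:ℝ) * (m*t)^2 = m^2/t := by rw [hNe]; field_simp
    obtain ⟨d1, d2, d3, d4, e1, e2, e3, e4, e5, e6, e7, e8⟩ := moments N h2 (m^2/t) (P t/t^2) (Q t/t^2) (by positivity) (by positivity)
      (by rw [hP, hQ]; simp only; field_simp; ring)
      (by
        have := Rsq t
        rw [hNe, hP, hQ]; simp only; field_simp; linear_combination this)
    rw [hx]
    refine ⟨d1, t^2 * d2, t^4 * d3, fun _ => ⟨?_, ?_, ?_, ?_, ?_, ?_⟩⟩
    · generalize Lag (N-2) 1 (-(m^2/t)) = A at *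
      generalize Lag (N-1) 1 (-(m^2/t)) = B at *
      have : A = t^3 * (N * A) := by linear_combination (-A) * hNt
      rw [this, e1, hNe]; field_simp
    · have : t^2 * d2 + (P t + Q t) * d1 = t^2 * (d2 + (P t/t^2 + Q t/t^2) * d1) := by field_simp
      rw [this, e2, mul_zero]
    · have : t^4 * d3 + (P t + Q t) * (t^2 * d2) = t^4 * (d3 + (P t/t^2 + Q t/t^2) * d2) := by field_simp
      rw [this, e3, hNe]; field_simp
    · positivity
    · have e5' : Q t * (t^2 * d2) ≤ m^2 := by
        have := mul_le_mul_of_nonneg_left e5 (show 0 ≤ t^4 by positivity)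
        calc Q t * (t^2 * d2) = t^4 * (Q t/t^2 * d2) := by field_simp
          _ ≤ _ := this
          _ = m^2 := by rw [hNe]; field_simp
      have : 0 ≤ t^2 * d2 := by positivity
      have : m/2 * (t^2 * d2) ≤ m^2 := le_trans (by gcongr) e5'
      nlinarith
    · have e5' : Q t * (t^2 * d2) ≤ m^2 := by
        have := mul_le_mul_of_nonneg_left e5 (show 0 ≤ t^4 by positivity)
        calc Q t * (t^2 * d2) = t^4 * (Q t/t^2 * d2) := by field_simp
          _ ≤ _ := this
          _ = m^2 := by rw [hNe]; field_simp
      have : 0 ≤ t^2 * d2 := by positivity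
      have : m/2 * (t^2 * d2) ≤ m^2 := le_trans (by gcongr) e5'
      have hD2 : t^2 * d2 ≤ 2 * m := by nlinarith
      have e7' : Q t * (t^4 * d4) ≤ m^2 * (5 * (t^2*d2) + 3 * t^2) := by
        have := mul_le_mul_of_nonneg_left e7 (show 0 ≤ t^6 by positivity)
        calc Q t * (t^4 * d4) = t^6 * (Q t/t^2 * d4) := by field_simp
          _ ≤ _ := this
          _ = _ := by rw [hNe]; field_simp
      have h4 : 0 ≤ t^4 * d4 := by positivity
      have h5 : m/2 * (t^4 * d4) ≤ m^2 * (10 * m + 3) := by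
        calc m/2 * (t^4 * d4) ≤ Q t * (t^4 * d4) := by gcongr
          _ ≤ _ := e7'
          _ ≤ m^2 * (5 * (2*m) + 3 * 1) := by
            gcongr
            exact pow_le_one₀ ht.le ht1.le
          _ = _ := by ring
      have hD4 : t^4 * d4 ≤ 2 * m * (10 * m + 3) := by
        refine le_of_mul_le_mul_left ?_ (half_pos hm)
        linarith
      have e8' := e8 t ht
      rw [abs_mul, abs_of_pos (show 0 < t^4 by positivity)]
      have h9 : t^4 * (2 * |d3|) ≤ t * (t^2 * d2) + t * (t^4 * d4) := by
        calc _ ≤ t^4 * (d2 / t + d4 * t) := by gcongr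
          _ = _ := by field_simp
      have h10 : t * (t^2 * d2) ≤ t * (2 * m) := by gcongr
      have h11 : t * (t^4 * d4) ≤ t * (2 * m * (10 * m + 3)) := by gcongr
      have h12 : 0 ≤ t^4 * |d3| := by positivity
      linarith
  choose d1 D2 D3 hd using main
  have hD3 : Tendsto D3 atTop (𝓝 0) := by
    refine squeeze_zero_norm' (a := fun N => h N * (2 * m + 2 * m * (10 * m + 3))) ?_ ?_
    · filter_upwards [good] with N hg
      exact (hd N hg).2.2.2.2.2
    · simpa using h0.mul_const (2 * m + 2 * m * (10 * m + 3))
  have PQ : Tendsto (fun N => P (h N) + Q (h N)) atTop (𝓝 (m+m)) := Plim.add Qlim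
  have hd1 : Tendsto (fun N => h N ^ 3 * d1 N) atTop (𝓝 0) := by
    refine squeeze_zero_norm' (a := fun N => h N ^ 3 * 4) ?_ ?_
    · filter_upwards [good] with N hg
      obtain ⟨-, k2, -, k4, k5, -⟩ := hd N hg
      obtain ⟨h2, ht, ht1, hNt, hPp, hQp⟩ := hg
      rw [norm_mul, Real.norm_eq_abs, Real.norm_eq_abs, abs_of_pos (show 0 < h N^3 by positivity)]
      gcongr
      have hs : m/2 < P (h N) + Q (h N) := by linarith
      have : d1 N = - (D2 N / (P (h N) + Q (h N))) := by
        have : P (h N) + Q (h N) ≠ 0 := by linarith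
        field_simp; linarith
      have hs0 : 0 < P (h N) + Q (h N) := by linarith
      rw [this, abs_neg, abs_of_nonneg (div_nonneg k4 hs0.le), div_le_iff₀ hs0]
      linarith
    · simpa using (h0.pow 3).mul_const 4
  have hD2 : Tendsto D2 atTop (𝓝 (m/2)) := by
    have : Tendsto (fun N => (m^2 * (1 - h N^3 - h N * P (h N) - h N ^3 * d1 N) - D3 N) / (P (h N) + Q (h N))) atTop
      (𝓝 ((m^2 * (1 - 0^3 - 0 * m - 0) - 0)/(m+m))) := by
      refine Tendsto.div (((((tendsto_const_nhds.sub (h0.pow 3)).sub (h0.mul Plim)).sub hd1).const_mul _).sub hD3) PQ (by positivity)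
    rw [show (m^2 * (1 - 0^3 - 0 * m - 0) - 0)/(m+m) = m/2 by field_simp; ring] at this
    refine this.congr' ?_
    filter_upwards [good] with N hg
    obtain ⟨-, -, k3, -, -, -⟩ := hd N hg
    obtain ⟨h2, ht, ht1, hNt, hPp, hQp⟩ := hg
    have : P (h N) + Q (h N) ≠ 0 := by linarith
    rw [div_eq_iff this]; linarith
  have hd1' : Tendsto d1 atTop (𝓝 (-1/4)) := by
    have : Tendsto (fun N => -(D2 N / (P (h N) + Q (h N)))) atTop (𝓝 (-((m/2)/(m+m)))) := (hD2.div PQ (by positivity)).neg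
    rw [show -((m/2)/(m+m)) = -1/4 by field_simp; ring] at this
    refine this.congr' ?_
    filter_upwards [good] with N hg
    obtain ⟨-, k2, -, -, -, -⟩ := hd N hg
    obtain ⟨h2, ht, ht1, hNt, hPp, hQp⟩ := hg
    have : P (h N) + Q (h N) ≠ 0 := by linarith
    field_simp; linarith
  have tau : Tendsto (fun N => 1 + T (h N) + d1 N) atTop (𝓝 (1 + (m^3/8 - 1/2) + -1/4)) := (tendsto_const_nhds.add Tlim).add hd1'
  have fin : Tendsto (fun N => (fun z : ℝ × ℝ => 2 - (3*m-2*α)*z.1 + m*(α-m)^2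
      - (2 + (2*α-m)*z.1 + 2*m*(α-m)*z.1^2 + m*(α-m)^2*z.1^3) * z.2
      + ((2*α-m)*m^2/2 + m^3*(α-m)*z.1 + m^3*(α-m)^2*z.1^2/2) - m*(2*m*(α-m) + m*(α-m)^2*z.1)) (h N, 1 + T (h N) + d1 N)) atTop
      (𝓝 (3/2 + m * (3 * m / 2 - α)^2)) := by
    have hc : Continuous (fun z : ℝ × ℝ => 2 - (3*m-2*α)*z.1 + m*(α-m)^2
      - (2 + (2*α-m)*z.1 + 2*m*(α-m)*z.1^2 + m*(α-m)^2*z.1^3) * z.2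
      + ((2*α-m)*m^2/2 + m^3*(α-m)*z.1 + m^3*(α-m)^2*z.1^2/2) - m*(2*m*(α-m) + m*(α-m)^2*z.1)) := by fun_prop
    have := (hc.tendsto (0, 1 + (m^3/8 - 1/2) + -1/4)).comp (h0.prodMk_nhds tau)
    refine this.trans (le_of_eq ?_)
    congr 1; simp only; ring
  refine fin.congr' ?_
  filter_upwards [good] with N hg
  obtain ⟨k1, -, -, -, -, -⟩ := hd N hg
  obtain ⟨h2, ht, ht1, hNt, hPp, hQp⟩ := hg
  rw [k1, PT]
  have hL : 0 < Lag (N - 1) 1 (-(N * (m * h N)^2)) := by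
    rw [lag_eq N h2]; exact ww_pos N h2 _ (by positivity)
  generalize Lag (N - 1) 1 (-(N * (m * h N)^2)) = B at *
  have hNe : (N:ℝ) = 1/h N^3 := by field_simp; exact hNt
  rw [hNe]
  generalize h N = t at *
  field_simp
  ring

lemma contour (N : ℕ) (x s : ℝ) (hs : 0 < s) :
    (∮ v in C(0, 1), (1 + (s:ℂ) / v)^N * Complex.exp (((x/s : ℝ):ℂ) * v)) =
      2 * Real.pi * Complex.I * s * ((∑ k ∈ Finset.range N, WW N x k : ℝ) : ℂ) := by
  have hdiff : ∀ a : ℂ, Differentiable ℂ (fun v => Complex.exp (a * v)) := fun a => by fun_prop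
  have e1 : ∀ k : ℕ, (∮ v in C(0, 1), (1/v^(k+1)) * Complex.exp (((x/s : ℝ):ℂ) * v)) =
      2 * Real.pi * Complex.I * ((x/s : ℝ):ℂ)^k / (k.factorial : ℂ) := by
    intro k
    have := DiffContOnCl.circleIntegral_one_div_sub_center_pow_smul (c := 0) (R := 1) one_pos k
      (f := fun v => Complex.exp (((x/s : ℝ):ℂ) * v)) (hdiff _).diffContOnCl
    simp only [sub_zero, smul_eq_mul] at this
    rw [this, iteratedDeriv_cexp_const_mul]
    simp; ring
  have e0 : (∮ v in C(0, 1), Complex.exp (((x/s : ℝ):ℂ) * v)) = 0 := 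
    Complex.circleIntegral_eq_zero_of_differentiable_on_off_countable zero_le_one Set.countable_empty
      (hdiff _).continuous.continuousOn (fun z _ => (hdiff _) z)
  have e2 : (∮ v in C(0, 1), (1 + (s:ℂ) / v)^N * Complex.exp (((x/s : ℝ):ℂ) * v)) =
     ∮ v in C(0, 1), ∑ j ∈ Finset.range (N+1), ((N.choose j : ℂ) * s^j) * ((1/v^j) * Complex.exp (((x/s : ℝ):ℂ) * v)) := by
    congr 1; funext v
    rw [add_comm (1:ℂ), add_pow, Finset.sum_mul]
    refine Finset.sum_congr rfl fun j _ => ?_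
    rw [div_pow]; simp; ring
  have hint : ∀ j : ℕ, CircleIntegrable (fun v : ℂ => ((N.choose j : ℂ) * s^j) * ((1/v^j) * Complex.exp (((x/s : ℝ):ℂ) * v))) 0 1 := by
    intro j
    apply ContinuousOn.circleIntegrable zero_le_one
    refine ContinuousOn.mul (by fun_prop) (ContinuousOn.mul (ContinuousOn.div (by fun_prop) (by fun_prop) ?_) (by fun_prop))
    intro v hv
    have : v ≠ 0 := by rintro rfl; simp at hv
    exact pow_ne_zero _ this
  rw [e2, circleIntegral.integral_fun_sum (fun j _ => hint j), Finset.sum_range_succ']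
  simp only [circleIntegral.integral_const_mul, e1]
  simp only [pow_zero, div_one, one_mul, e0, mul_zero, add_zero]
  push_cast
  rw [Finset.mul_sum]
  refine Finset.sum_congr rfl fun k _ => ?_
  rw [WW]
  have : (s:ℂ) ≠ 0 := by exact_mod_cast hs.ne'
  have : (k.factorial : ℂ) ≠ 0 := by exact_mod_cast k.factorial_ne_zero
  push_cast
  rw [div_pow]
  field_simp
  ring

lemma contour2 (N : ℕ) (x s h : ℝ) (hs : 0 < s) (hh : 0 < h) :
    (∫ t in (-(Real.pi/h))..(Real.pi/h), Complex.exp ((h*t : ℝ) * Complex.I) * (1 + (s:ℂ) * Complex.exp (-((h*t : ℝ) * Complex.I)))^N *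
      Complex.exp (((x/s : ℝ):ℂ) * Complex.exp ((h*t : ℝ) * Complex.I))) =
      2 * Real.pi * s / h * ((∑ k ∈ Finset.range N, WW N x k : ℝ) : ℂ) := by
  have h1 := contour N x s hs
  rw [circleIntegral] at h1
  simp only [deriv_circleMap, circleMap, Complex.ofReal_one, one_mul, zero_add, smul_eq_mul] at h1
  set F : ℝ → ℂ := fun θ => Complex.exp ((θ : ℝ) * Complex.I) * (1 + (s:ℂ) * Complex.exp (-((θ : ℝ) * Complex.I)))^N *
      Complex.exp (((x/s : ℝ):ℂ) * Complex.exp ((θ : ℝ) * Complex.I)) with hF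
  have h2 : (∫ θ in (0:ℝ)..2*Real.pi, F θ) = 2 * Real.pi * s * ((∑ k ∈ Finset.range N, WW N x k : ℝ) : ℂ) := by
    have h3 : (∫ θ in (0:ℝ)..2*Real.pi, Complex.I * F θ) = Complex.I * (2 * Real.pi * s * ((∑ k ∈ Finset.range N, WW N x k : ℝ) : ℂ)) := by
      refine Eq.trans ?_ (h1.trans (by ring))
      congr 1; funext θ
      simp only [hF, Complex.exp_neg]; ring
    rw [intervalIntegral.integral_const_mul] at h3
    exact mul_left_cancel₀ Complex.I_ne_zero h3
  have hper : Function.Periodic F (2*Real.pi) := by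
    intro θ
    have : Complex.exp (((θ + 2*Real.pi : ℝ)) * Complex.I) = Complex.exp (θ * Complex.I) := by
      push_cast; rw [add_mul]; exact Complex.exp_periodic _
    simp only [hF, Complex.exp_neg, this]
  have h4 := hper.intervalIntegral_add_eq 0 (-Real.pi)
  rw [zero_add, h2, show -Real.pi + 2*Real.pi = Real.pi by ring] at h4
  have h5 := intervalIntegral.integral_comp_mul_left (a := -(Real.pi/h)) (b := Real.pi/h) F hh.ne'
  rw [show h * -(Real.pi/h) = -Real.pi by field_simp, show h * (Real.pi/h) = Real.pi by field_simp, ← h4] at h5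
  refine h5.trans ?_
  rw [Complex.real_smul]; push_cast; ring

lemma sin_lim (c : ℝ) : Tendsto (fun h : ℝ => Real.sin (h * c) / h) (𝓝[>] 0) (𝓝 c) := by
  have h1 : HasDerivAt (fun h : ℝ => Real.sin (h * c)) c 0 := by
    have := ((hasDerivAt_id (0:ℝ)).mul_const c).sin
    simpa using this
  have h2 := hasDerivAt_iff_tendsto_slope_zero.1 h1
  have h3 := h2.mono_left (nhdsWithin_mono 0 (fun x (hx : x ∈ Set.Ioi (0:ℝ)) => ne_of_gt hx))
  refine h3.congr fun h => ?_
  simp [div_eq_inv_mul]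

lemma ptw (m : ℝ) (hm : 0 < m) (t : ℝ) (h : ℕ → ℝ) (hh : Tendsto h atTop (𝓝[>] 0))
    (hN : ∀ᶠ N : ℕ in atTop, (N:ℝ) * h N ^ 3 = 1) (s a : ℕ → ℝ) (hs : s = fun N => m * h N + (m * h N)^2/2)
    (ha : a = fun N => (N * (m * h N)^2) / s N) :
    Tendsto (fun N => Complex.exp ((h N*t : ℝ) * Complex.I) * ((1 + (s N:ℂ) * Complex.exp (-((h N*t : ℝ) * Complex.I)))/(1 + s N))^N *
      Complex.exp ((a N:ℂ) * (Complex.exp ((h N*t : ℝ) * Complex.I) - 1))) atTop (𝓝 ((Real.exp (-m * t^2) : ℝ) : ℂ)) := by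
  have h0 : Tendsto h atTop (𝓝 0) := hh.mono_right nhdsWithin_le_nhds
  have hpos : ∀ᶠ N in atTop, 0 < h N := hh.eventually self_mem_nhdsWithin
  have good : ∀ᶠ N : ℕ in atTop, 0 < h N ∧ h N < 1 ∧ (N:ℝ) * h N ^ 3 = 1 := by
    filter_upwards [hpos, h0.eventually (gt_mem_nhds one_pos), hN] with N b c d
    exact ⟨b, c, d⟩
  have e1 : Tendsto (fun N => Complex.exp ((h N*t : ℝ) * Complex.I)) atTop (𝓝 1) := by
    have hc : Continuous (fun y : ℝ => Complex.exp ((y*t : ℝ) * Complex.I)) := by fun_prop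
    have := (hc.tendsto 0).comp h0
    simpa [Function.comp_def] using this
  set u : ℕ → ℂ := fun N => (s N:ℂ) * (Complex.exp (-((h N*t : ℝ) * Complex.I)) - 1) / (1 + s N) with hu
  have ubd : ∀ᶠ N in atTop, ‖u N‖ ≤ h N^2 * ((m + m^2) * |t|) := by
    filter_upwards [good] with N ⟨g1, g2, g3⟩
    have hsp : 0 ≤ s N := by rw [hs]; positivity
    have hsb : s N ≤ h N * (m + m^2) := by
      rw [hs]; simp only
      nlinarith [mul_pos hm hm, mul_pos (mul_pos hm hm) g1]
    have n1 : ‖Complex.exp (-((h N*t : ℝ) * Complex.I)) - 1‖ ≤ h N * |t| := by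
      have := Real.norm_exp_I_mul_ofReal_sub_one_le (x := -(h N * t))
      rw [Real.norm_eq_abs, abs_neg, abs_mul, abs_of_pos g1] at this
      refine le_trans (le_of_eq ?_) this
      congr 3; push_cast; ring
    have n2 : ‖(1 + (s N:ℂ))‖ = 1 + s N := by
      have : (1 + (s N:ℂ)) = ((1 + s N : ℝ) : ℂ) := by push_cast; ring
      rw [this, Complex.norm_real, Real.norm_of_nonneg (by positivity)]
    simp only [hu]
    rw [norm_div, norm_mul, n2, Complex.norm_real, Real.norm_of_nonneg hsp, div_le_iff₀ (by positivity)]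
    calc s N * ‖Complex.exp (-((h N*t : ℝ) * Complex.I)) - 1‖ ≤ (h N * (m+m^2)) * (h N * |t|) := by gcongr
      _ = h N^2 * ((m + m^2) * |t|) * 1 := by ring
      _ ≤ _ := by gcongr; linarith
  set C := (m + m^2) * |t| with hC
  have hC0 : 0 ≤ C := by positivity
  have usmall : ∀ᶠ N in atTop, ‖u N‖ ≤ 1/2 := by
    have : Tendsto (fun N => h N^2 * C) atTop (𝓝 (0^2 * C)) := (h0.pow 2).mul_const C
    rw [show (0:ℝ)^2 * C = 0 by ring] at this
    filter_upwards [ubd, this.eventually (gt_mem_nhds (show (0:ℝ) < 1/2 by norm_num))] with N h1 h2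
    linarith
  have e2 : Tendsto (fun N : ℕ => (N:ℂ) * Complex.log (1 + u N) - N * u N) atTop (𝓝 0) := by
    refine squeeze_zero_norm' (a := fun N => h N * C^2) ?_ ?_
    · filter_upwards [good, ubd, usmall] with N ⟨g1, g2, g3⟩ h1 h2
      rw [← mul_sub, norm_mul, Complex.norm_natCast]
      have k := Complex.norm_log_one_add_sub_self_le (z := u N) (by linarith)
      have k2 : (1 - ‖u N‖)⁻¹ ≤ 2 := by
        rw [inv_le_comm₀ (by linarith) (by norm_num)]; linarith
      have k3 : ‖Complex.log (1 + u N) - u N‖ ≤ (h N^2 * C)^2 := by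
        calc _ ≤ ‖u N‖^2 * (1 - ‖u N‖)⁻¹ / 2 := k
          _ ≤ ‖u N‖^2 * 2 / 2 := by gcongr
          _ = ‖u N‖^2 := by ring
          _ ≤ _ := by gcongr
      calc (N:ℝ) * ‖Complex.log (1 + u N) - u N‖ ≤ N * (h N^2 * C)^2 := by gcongr
        _ = (N * h N^3) * (h N * C^2) := by ring
        _ = h N * C^2 := by rw [g3, one_mul]
    · simpa using h0.mul_const (C^2)
  have e3 : Tendsto (fun N : ℕ => (N:ℂ) * u N + (a N:ℂ) * (Complex.exp ((h N*t : ℝ) * Complex.I) - 1)) atTop (𝓝 ((-m * t^2 : ℝ) : ℂ)) := by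
    have hsin := (sin_lim t).comp hh
    have hsin2 := (sin_lim (t/2)).comp hh
    have c1 : Tendsto (fun N => m/(1+m*h N/2) + (m+m^2*h N/2)/(1 + m * h N + (m * h N)^2/2)) atTop (𝓝 (m + m)) := by
      have : ContinuousAt (fun y : ℝ => m/(1+m*y/2) + (m+m^2*y/2)/(1 + m * y + (m * y)^2/2)) 0 :=
        ContinuousAt.add (ContinuousAt.div (by fun_prop) (by fun_prop) (by simp)) (ContinuousAt.div (by fun_prop) (by fun_prop) (by simp))
      have := this.tendsto.comp h0
      simpa [Function.comp_def] using this
    have c2 : Tendsto (fun N => h N * (m^3/4) / ((1+m*h N/2)*(1 + m * h N + (m * h N)^2/2))) atTop (𝓝 0) := by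
      have : ContinuousAt (fun y : ℝ => y * (m^3/4) / ((1+m*y/2)*(1 + m * y + (m * y)^2/2))) 0 :=
        (ContinuousAt.div (by fun_prop) (by fun_prop) (by simp))
      have := this.tendsto.comp h0
      simpa [Function.comp_def] using this
    have re : Tendsto (fun N => (m/(1+m*h N/2) + (m+m^2*h N/2)/(1 + m * h N + (m * h N)^2/2)) * (-2 * (Real.sin (h N * (t/2))/h N)^2)) atTop (𝓝 (-m*t^2)) := by
      have := c1.mul ((hsin2.pow 2).const_mul (-2))
      rw [show (m+m) * (-2 * (t/2)^2) = -m * t^2 by ring] at this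
      exact this
    have im : Tendsto (fun N => (h N * (m^3/4) / ((1+m*h N/2)*(1 + m * h N + (m * h N)^2/2))) * (Real.sin (h N * t)/h N)) atTop (𝓝 0) := by
      have := c2.mul hsin
      rw [zero_mul] at this
      exact this
    have := ((Complex.continuous_ofReal.tendsto _).comp re).add (((Complex.continuous_ofReal.tendsto _).comp im).mul_const Complex.I)
    simp only [Complex.ofReal_zero, zero_mul, add_zero] at this
    refine this.congr' ?_
    filter_upwards [good] with N ⟨g1, g2, g3⟩
    have hNe : (N:ℝ) = 1/h N^3 := by field_simp; exact g3
    have hNc : (N:ℂ) = ((1/h N^3 : ℝ) : ℂ) := by rw [← hNe]; simp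
    have hA : a N = m/(1+m*h N/2) / h N^2 := by
      rw [ha, hs]; simp only; rw [hNe]; field_simp
    have hB : (N:ℂ) * ((s N : ℂ) / (1 + s N)) = (((m+m^2*h N/2)/(1 + m * h N + (m * h N)^2/2) / h N^2 : ℝ) : ℂ) := by
      have : (N:ℝ) * (s N / (1 + s N)) = (m+m^2*h N/2)/(1 + m * h N + (m * h N)^2/2) / h N^2 := by
        have : 1 + (m * h N + (m * h N)^2/2) ≠ 0 := by positivity
        have : 1 + m * h N + (m * h N)^2/2 ≠ 0 := by positivity
        rw [hs]; simp only; rw [hNe, show 1 + m * h N + (m * h N)^2/2 = 1 + (m * h N + (m * h N)^2/2) by ring]; field_simp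
      rw [← this]; push_cast; ring
    have hu' : (N:ℂ) * u N = ((N:ℂ) * ((s N : ℂ) / (1 + s N))) * (Complex.exp (-((h N*t : ℝ) * Complex.I)) - 1) := by
      simp only [hu]; ring
    rw [hu', hB, hA, ← neg_mul, ← Complex.ofReal_neg, Complex.exp_mul_I, Complex.exp_mul_I]
    rw [← Complex.ofReal_cos, ← Complex.ofReal_cos, ← Complex.ofReal_sin, ← Complex.ofReal_sin, Real.cos_neg, Real.sin_neg]
    have hcos : Real.cos (h N * t) = 1 - 2 * Real.sin (h N * (t/2))^2 := by
      have := Real.cos_sq' (h N * (t/2))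
      have h2 := Real.cos_two_mul (h N * (t/2))
      rw [show 2 * (h N * (t/2)) = h N * t by ring] at h2
      rw [h2, this]; ring
    rw [hcos]
    simp only [Function.comp]
    generalize Real.sin (h N * (t/2)) = σ
    generalize Real.sin (h N * t) = τ
    have d1 : 1 + m * h N/2 ≠ 0 := by positivity
    have d2 : 1 + m * h N + (m * h N)^2/2 ≠ 0 := by positivity
    generalize h N = y at *
    have d3 : (m / (1 + m*y/2) - (m+m^2*y/2)/(1 + m * y + (m * y)^2/2)) / y = y * (m^3/4) / ((1+m*y/2)*(1 + m * y + (m * y)^2/2)) := by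
      rw [div_sub_div _ _ d1 d2, div_div, div_eq_div_iff (by positivity) (by positivity)]; ring
    rw [← d3]
    generalize m / (1 + m*y/2) = A
    generalize (m+m^2*y/2)/(1 + m * y + (m * y)^2/2) = B
    have hy : (y:ℂ) ≠ 0 := by exact_mod_cast g1.ne'
    push_cast
    field_simp
    ring
  have e4 := (Complex.continuous_exp.tendsto _).comp (e2.add e3)
  have e5 := e1.mul e4
  rw [zero_add, one_mul, ← Complex.ofReal_exp] at e5
  refine e5.congr' ?_
  filter_upwards [good, usmall] with N ⟨g1, g2, g3⟩ h2
  have hsp : 0 ≤ s N := by rw [hs]; positivity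
  have hs1 : (1 + (s N:ℂ)) ≠ 0 := by
    have : (1 + (s N:ℂ)) = ((1 + s N : ℝ) : ℂ) := by push_cast; ring
    rw [this]; exact_mod_cast (by positivity : (1 + s N) ≠ 0)
  have h3 : (1 + (s N:ℂ) * Complex.exp (-((h N*t : ℝ) * Complex.I)))/(1 + s N) = 1 + u N := by
    simp only [hu]; field_simp; ring
  have h4 : 1 + u N ≠ 0 := by
    intro h; have : u N = -1 := by linear_combination h
    rw [this] at h2; norm_num at h2
  rw [h3, mul_assoc]
  congr 1
  simp only [Function.comp]
  rw [show (N:ℂ) * Complex.log (1 + u N) - N * u N + (N * u N + (a N:ℂ) * (Complex.exp ((h N*t : ℝ) * Complex.I) - 1)) = N * Complex.log (1 + u N) + (a N:ℂ) * (Complex.exp ((h N*t : ℝ) * Complex.I) - 1) by ring, Complex.exp_add, Complex.exp_nat_mul, Complex.exp_log h4]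

lemma lag_lim (m : ℝ) (hm : 0 < m) (h : ℕ → ℝ) (hh : Tendsto h atTop (𝓝[>] 0))
    (hN : ∀ᶠ N : ℕ in atTop, (N:ℝ) * h N ^ 3 = 1) (s a : ℕ → ℝ) (hs : s = fun N => m * h N + (m * h N)^2/2)
    (ha : a = fun N => (N * (m * h N)^2) / s N) :
    Tendsto (fun N : ℕ => Lag (N-1) 1 (-(N * (m * h N)^2)) / ((1 + s N)^N * Real.exp (a N))) atTop
      (𝓝 (1 / (2 * Real.sqrt Real.pi) * m ^ (-(3:ℝ)/2))) := by
  have h0 : Tendsto h atTop (𝓝 0) := hh.mono_right nhdsWithin_le_nhds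
  have hpos : ∀ᶠ N in atTop, 0 < h N := hh.eventually self_mem_nhdsWithin
  have hahlim : Tendsto (fun N => m/(1+m*h N/2)) atTop (𝓝 m) := by
    have : ContinuousAt (fun y : ℝ => m/(1+m*y/2)) 0 := ContinuousAt.div (by fun_prop) (by fun_prop) (by simp)
    have := this.tendsto.comp h0
    simpa [Function.comp_def] using this
  have good : ∀ᶠ N : ℕ in atTop, 2 ≤ N ∧ 0 < h N ∧ (N:ℝ) * h N ^ 3 = 1 ∧ 0 < s N ∧ m/2 ≤ a N * h N^2 := by
    filter_upwards [eventually_ge_atTop 2, hpos, hN, hahlim.eventually (lt_mem_nhds (half_lt_self hm))] with N n2 b c d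
    refine ⟨n2, b, c, ?_, ?_⟩
    · rw [hs]; positivity
    · have hNe : (N:ℝ) = 1/h N^3 := by field_simp; exact c
      have : a N * h N^2 = m/(1+m*h N/2) := by
        rw [ha, hs]; simp only; rw [hNe]; field_simp
      rw [this]; exact d.le
  set G : ℕ → ℝ → ℂ := fun N t => Complex.exp ((h N*t : ℝ) * Complex.I) * ((1 + (s N:ℂ) * Complex.exp (-((h N*t : ℝ) * Complex.I)))/(1 + s N))^N *
      Complex.exp ((a N:ℂ) * (Complex.exp ((h N*t : ℝ) * Complex.I) - 1)) with hG
  have Gc : ∀ N, Continuous (G N) := by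
    intro N; simp only [hG, div_eq_mul_inv]; fun_prop
  have key : Tendsto (fun N => ∫ t : ℝ, (Set.Ioc (-(Real.pi/h N)) (Real.pi/h N)).indicator (G N) t) atTop
      (𝓝 (∫ t : ℝ, ((Real.exp (-m * t^2) : ℝ) : ℂ))) := by
    refine MeasureTheory.tendsto_integral_filter_of_dominated_convergence (fun t => Real.exp (-(m/Real.pi^2) * t^2)) ?_ ?_ ?_ ?_
    · exact Eventually.of_forall fun N => (Gc N).aestronglyMeasurable.indicator measurableSet_Ioc
    · filter_upwards [good] with N ⟨n2, g1, g3, gs, ga⟩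
      refine Eventually.of_forall fun t => ?_
      by_cases ht : t ∈ Set.Ioc (-(Real.pi/h N)) (Real.pi/h N)
      swap
      · rw [Set.indicator_of_notMem ht, norm_zero]; positivity
      rw [Set.indicator_of_mem ht]
      have habs : |h N * t| ≤ Real.pi := by
        rw [abs_mul, abs_of_pos g1]
        have : |t| ≤ Real.pi/h N := abs_le.2 ⟨ht.1.le, ht.2⟩
        rwa [le_div_iff₀ g1, mul_comm] at this
      have hcos := Real.cos_le_one_sub_mul_cos_sq habs
      simp only [hG]
      rw [norm_mul, norm_mul, norm_pow, norm_div, Complex.norm_exp_ofReal_mul_I, Complex.norm_exp, one_mul]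
      have n1 : ‖(1 + (s N:ℂ))‖ = 1 + s N := by
        have : (1 + (s N:ℂ)) = ((1 + s N : ℝ) : ℂ) := by push_cast; ring
        rw [this, Complex.norm_real, Real.norm_of_nonneg (by positivity)]
      have n2 : ‖1 + (s N:ℂ) * Complex.exp (-((h N*t : ℝ) * Complex.I))‖ ≤ 1 + s N := by
        refine (norm_add_le _ _).trans ?_
        rw [norm_mul, ← neg_mul, ← Complex.ofReal_neg, Complex.norm_exp_ofReal_mul_I, norm_one, mul_one, Complex.norm_real, Real.norm_of_nonneg gs.le]
      have n3 : (‖1 + (s N:ℂ) * Complex.exp (-((h N*t : ℝ) * Complex.I))‖ / ‖(1 + (s N:ℂ))‖)^N ≤ 1 := by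
        apply pow_le_one₀ (by positivity)
        rw [n1, div_le_one (by positivity)]; exact n2
      have n4 : ((a N:ℂ) * (Complex.exp ((h N*t : ℝ) * Complex.I) - 1)).re = a N * (Real.cos (h N * t) - 1) := by
        rw [Complex.re_ofReal_mul, Complex.sub_re, Complex.exp_ofReal_mul_I_re, Complex.one_re]
      rw [n4]
      refine (mul_le_of_le_one_left (Real.exp_pos _).le n3).trans ?_
      apply Real.exp_le_exp.2
      have ha0 : 0 < a N := by
        by_contra hc
        have : a N * h N^2 ≤ 0 := mul_nonpos_of_nonpos_of_nonneg (not_lt.1 hc) (by positivity)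
        linarith
      calc a N * (Real.cos (h N * t) - 1) ≤ a N * (- (2/Real.pi^2 * (h N * t)^2)) := by gcongr; linarith
        _ = - ((a N * h N^2) * (2/Real.pi^2 * t^2)) := by ring
        _ ≤ - ((m/2) * (2/Real.pi^2 * t^2)) := by gcongr
        _ = _ := by ring
    · exact integrable_exp_neg_mul_sq (by positivity)
    · refine Eventually.of_forall fun t => ?_
      refine (ptw m hm t h hh hN s a hs ha).congr' ?_
      have : ∀ᶠ N in atTop, h N * |t| < Real.pi := by
        have : Tendsto (fun N => h N * |t|) atTop (𝓝 (0 * |t|)) := h0.mul_const _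
        rw [zero_mul] at this
        exact this.eventually (gt_mem_nhds Real.pi_pos)
      filter_upwards [this, hpos] with N h1 h2
      have h3 : |t| < Real.pi/h N := by rwa [lt_div_iff₀ h2, mul_comm]
      have h4 := abs_lt.1 h3
      rw [Set.indicator_of_mem (show t ∈ Set.Ioc (-(Real.pi/h N)) (Real.pi/h N) from ⟨h4.1, h4.2.le⟩)]
  have hI : (∫ t : ℝ, ((Real.exp (-m * t^2) : ℝ) : ℂ)) = ((Real.sqrt (Real.pi/m) : ℝ) : ℂ) := by
    rw [integral_complex_ofReal, integral_gaussian]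
  rw [hI] at key
  have key2 : Tendsto (fun N : ℕ => 2 * Real.pi * s N / h N * (Lag (N-1) 1 (-(N * (m * h N)^2)) / ((1 + s N)^N * Real.exp (a N)))) atTop
      (𝓝 (Real.sqrt (Real.pi/m))) := by
    have k := (Complex.continuous_re.tendsto _).comp key
    rw [Complex.ofReal_re] at k
    refine k.congr' ?_
    filter_upwards [good] with N ⟨n2, g1, g3, gs, ga⟩
    simp only [Function.comp]
    rw [MeasureTheory.integral_indicator measurableSet_Ioc, ← intervalIntegral.integral_of_le (by
      have : 0 < Real.pi / h N := by positivity
      linarith)]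
    have hs1 : (1 + (s N:ℂ)) ≠ 0 := by
      have : (1 + (s N:ℂ)) = ((1 + s N : ℝ) : ℂ) := by push_cast; ring
      rw [this]; exact_mod_cast (by positivity : (1 + s N) ≠ 0)
    have hGe : G N = fun t => (1/((1 + (s N:ℂ))^N * Complex.exp (a N))) * (Complex.exp ((h N*t : ℝ) * Complex.I) * (1 + (s N:ℂ) * Complex.exp (-((h N*t : ℝ) * Complex.I)))^N *
      Complex.exp ((((N * (m * h N)^2)/s N : ℝ):ℂ) * Complex.exp ((h N*t : ℝ) * Complex.I))) := by
      funext t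
      have : (N * (m * h N)^2)/s N = a N := by rw [ha]
      rw [this]
      simp only [hG]
      rw [div_pow, mul_sub, mul_one, Complex.exp_sub]
      field_simp
    rw [hGe, intervalIntegral.integral_const_mul, contour2 N _ (s N) (h N) gs g1, ← lag_eq N n2]
    have : (1/((1 + (s N:ℂ))^N * Complex.exp (a N))) * (2 * Real.pi * s N / h N * ((Lag (N-1) 1 (-(N * (m * h N)^2)) : ℝ) : ℂ)) =
       ((2 * Real.pi * s N / h N * (Lag (N-1) 1 (-(N * (m * h N)^2)) / ((1 + s N)^N * Real.exp (a N))) : ℝ) : ℂ) := by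
      push_cast; ring
    rw [this, Complex.ofReal_re]
  have key3 : Tendsto (fun N => 2 * Real.pi * (m + m^2 * h N/2)) atTop (𝓝 (2 * Real.pi * m)) := by
    have hc : Continuous (fun y : ℝ => 2 * Real.pi * (m + m^2 * y/2)) := by fun_prop
    have := (hc.tendsto 0).comp h0
    simpa [Function.comp_def] using this
  have k4 := key2.div key3 (by positivity)
  have hval : Real.sqrt (Real.pi/m) / (2 * Real.pi * m) = 1 / (2 * Real.sqrt Real.pi) * m ^ (-(3:ℝ)/2) := by
    have : m ^ (-(3:ℝ)/2) = 1/(m * Real.sqrt m) := by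
      rw [show -(3:ℝ)/2 = -(1 + 1/2) by norm_num, Real.rpow_neg hm.le, Real.rpow_add hm, Real.rpow_one, ← Real.sqrt_eq_rpow, one_div]
    rw [this, Real.sqrt_div Real.pi_pos.le]
    have h1 : 0 < Real.sqrt m := Real.sqrt_pos.2 hm
    have h2 : 0 < Real.sqrt Real.pi := Real.sqrt_pos.2 Real.pi_pos
    have h3 := Real.sq_sqrt Real.pi_pos.le
    field_simp
    linear_combination h3
  rw [hval] at k4
  refine k4.congr' ?_
  filter_upwards [good] with N ⟨n2, g1, g3, gs, ga⟩
  have : s N / h N = m + m^2 * h N/2 := by rw [hs]; field_simp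
  simp only [Pi.div_apply]
  rw [← this]
  field_simp


lemma aux_log3 : Tendsto (fun x : ℝ => (Real.log (1 - x) + (x + x^2/2 + x^3/3)) / x^3) (𝓝 0) (𝓝 0) := by
  have hb : ∀ᶠ x : ℝ in 𝓝 0, ‖(Real.log (1 - x) + (x + x^2/2 + x^3/3)) / x^3‖ ≤ 2 * |x| := by
    have : ∀ᶠ x : ℝ in 𝓝 0, |x| < 1/2 := by
      have := Metric.ball_mem_nhds (0:ℝ) (show (0:ℝ) < 1/2 by norm_num)
      filter_upwards [this] with x hx
      simpa [Real.dist_eq] using hx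
    filter_upwards [this] with x hx
    have h1 := Real.abs_log_sub_add_sum_range_le (x := x) (by linarith) 3
    have h2 : (∑ i ∈ Finset.range 3, x ^ (i + 1) / ((i:ℝ) + 1)) = x + x^2/2 + x^3/3 := by
      simp [Finset.sum_range_succ]; norm_num
    rw [h2] at h1
    rw [Real.norm_eq_abs, abs_div, abs_pow]
    rcases eq_or_ne x 0 with rfl | h0
    · simp
    have hp : 0 < |x| := abs_pos.mpr h0
    rw [div_le_iff₀ (by positivity), add_comm]
    refine h1.trans ?_
    rw [div_le_iff₀ (by linarith)]
    have : 0 < |x|^4 := by positivity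
    norm_num
    nlinarith
  refine squeeze_zero_norm' hb ?_
  have : Tendsto (fun x : ℝ => 2 * |x|) (𝓝 0) (𝓝 (2 * |0|)) := by
    apply Continuous.tendsto; fun_prop
  simpa using this

lemma aux_logcomp (f : ℝ → ℝ) (c : ℝ) (hf : Tendsto (fun h => f h / h) (𝓝[>] 0) (𝓝 c)) (hf0 : Tendsto f (𝓝[>] 0) (𝓝 0)) 
    (hne : ∀ᶠ h in 𝓝[>] (0:ℝ), f h ≠ 0) :
    Tendsto (fun h => (Real.log (1 - f h) + (f h + f h^2/2 + f h^3/3)) / h^3) (𝓝[>] 0) (𝓝 0) := by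
  have h1 := (aux_log3.comp hf0).mul (hf.pow 3)
  rw [zero_mul] at h1
  refine h1.congr' ?_
  filter_upwards [hne, self_mem_nhdsWithin] with h hh h0
  have : h ≠ 0 := ne_of_gt h0
  simp only [Function.comp]
  field_simp

lemma aux_cont {f : ℝ → ℝ} {c : ℝ} (hf : ContinuousAt f 0) (hc : f 0 = c) : Tendsto f (𝓝[>] 0) (𝓝 c) := by
  rw [← hc]; exact hf.tendsto.mono_left nhdsWithin_le_nhds

lemma aux_expo (α m : ℝ) (hm : 0 < m) :
    Tendsto (fun h : ℝ => (Real.log (1 - m*h/(1+α*h)) + Real.log (1 + (m*h+m^2*h^2/2))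
      - m*h*(1+α*h-m*h) + m*h/(1+m*h/2)) / h^3) (𝓝[>] 0) (𝓝 (-m*(α-m/2)^2)) := by
  have e1 : ∀ᶠ h : ℝ in 𝓝[>] 0, 0 < 1 + α*h :=
    (aux_cont (f := fun h => 1 + α*h) (c := 1) (by fun_prop) (by simp)).eventually (lt_mem_nhds one_pos)
  have e0 : ∀ᶠ h : ℝ in 𝓝[>] 0, 0 < h := self_mem_nhdsWithin
  have c1 := aux_logcomp (fun h => m*h/(1+α*h)) m
    ((aux_cont (f := fun h => m/(1+α*h)) (c := m) (by
        refine ContinuousAt.div (by fun_prop) (by fun_prop) (by simp)) (by simp)).congr' (by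
        filter_upwards [e0, e1] with h h0 h1
        field_simp))
    (aux_cont (by refine ContinuousAt.div (by fun_prop) (by fun_prop) (by simp)) (by simp))
    (by filter_upwards [e0, e1] with h h0 h1
        positivity)
  have c2 := aux_logcomp (fun h => -(m*h+m^2*h^2/2)) (-m)
    ((aux_cont (f := fun h => -(m+m^2*h/2)) (c := -m) (by fun_prop) (by simp)).congr' (by
        filter_upwards [e0, e1] with h h0 h1
        field_simp))
    (aux_cont (by fun_prop) (by simp))
    (by filter_upwards [e0, e1] with h h0 h1
        have : 0 < m*h+m^2*h^2/2 := by positivity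
        linarith)
  have c3 : Tendsto (fun h : ℝ => -m*α^2*(1/(1+α*h)) + (m^2/2)*α*(1/(1+α*h))*(1/(1+α*h)+1)
     - m^3*(1/(1+α*h))^3/3 - m^3/2 - m^4*h/8 + (m+m^2*h/2)^3/3 + m^3*(1/(1+m*h/2))/4) (𝓝[>] 0) (𝓝 (-m*(α-m/2)^2)) := by
    have k1 : ContinuousAt (fun h : ℝ => 1/(1+α*h)) 0 := ContinuousAt.div (by fun_prop) (by fun_prop) (by simp)
    have k2 : ContinuousAt (fun h : ℝ => 1/(1+m*h/2)) 0 := ContinuousAt.div (by fun_prop) (by fun_prop) (by simp)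
    apply aux_cont
    · fun_prop
    · simp; ring
  have := (c1.add c2).add c3
  rw [zero_add, zero_add] at this
  refine this.congr' ?_
  filter_upwards [e0, e1] with h h0 h1
  have h2 : 0 < 1 + m*h/2 := by positivity
  rw [sub_neg_eq_add]
  generalize Real.log (1 - m*h/(1+α*h)) = A
  generalize Real.log (1 + (m*h+m^2*h^2/2)) = B
  obtain ⟨c, hc⟩ : ∃ c, c = 1 + α*h := ⟨_, rfl⟩
  obtain ⟨d, hd⟩ : ∃ d, d = 1 + m*h/2 := ⟨_, rfl⟩
  rw [← hc] at h1 ⊢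
  rw [← hd] at h2 ⊢
  have hα : α = (c-1)/h := by rw [hc]; field_simp; ring
  have hmd : m = 2*(d-1)/h := by rw [hd]; field_simp; ring
  rw [hα, hmd]
  clear hα hmd hc hd
  field_simp
  ring

theorem critical_scaling_density_imaginary_parts (α m : ℝ) (hm : 0 < m) :
    Filter.Tendsto
      (fun N : ℕ =>
        (N : ℝ) ^ ((2 : ℝ) / 3) *
          rhoIm N (1 + α * (N : ℝ) ^ (-(1 : ℝ) / 3)) (m * (N : ℝ) ^ (-(1 : ℝ) / 3)))
      Filter.atTop
      (nhds ((1 / (2 * Real.sqrt Real.pi)) * (3 / (2 * m) + (3 * m / 2 - α) ^ 2) *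
        m ^ (-(3 : ℝ) / 2) * Real.exp (-m * (α - m / 2) ^ 2))) := by
  obtain ⟨h, hh⟩ : ∃ h : ℕ → ℝ, h = fun N : ℕ => (N:ℝ) ^ (-(1:ℝ)/3) := ⟨_, rfl⟩
  have hlim : Tendsto h atTop (𝓝[>] 0) := by
    rw [hh]
    refine tendsto_nhdsWithin_iff.2 ⟨?_, ?_⟩
    · have := (tendsto_rpow_neg_atTop (show (0:ℝ) < 1/3 by norm_num)).comp (tendsto_natCast_atTop_atTop (R := ℝ))
      refine this.congr fun N => ?_
      simp only [Function.comp]; norm_num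
    · filter_upwards [eventually_ge_atTop 1] with N hN
      have : (0:ℝ) < N := by exact_mod_cast hN
      exact Real.rpow_pos_of_pos this _
  have h0 : Tendsto h atTop (𝓝 0) := hlim.mono_right nhdsWithin_le_nhds
  have hN3 : ∀ᶠ N : ℕ in atTop, (N:ℝ) * h N ^ 3 = 1 := by
    filter_upwards [eventually_ge_atTop 1] with N hN
    have : (0:ℝ) < N := by exact_mod_cast hN
    rw [hh]; simp only
    rw [← Real.rpow_natCast, ← Real.rpow_mul this.le]
    norm_num
    rw [Real.rpow_neg_one]; field_simp
  have l1 := bracket_lim α m hm h hlim hN3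
  have l2 := lag_lim m hm h hlim hN3 _ _ rfl rfl
  have l3 := (Real.continuous_exp.tendsto _).comp ((aux_expo α m hm).comp hlim)
  have l4 : Tendsto (fun N => 1/(m * (1 + α * h N)) / (1 - m * h N/(1 + α * h N))^2) atTop (𝓝 (1/m)) := by
    have k1 : ContinuousAt (fun y : ℝ => m * y/(1 + α*y)) 0 := ContinuousAt.div (by fun_prop) (by fun_prop) (by simp)
    have : ContinuousAt (fun y : ℝ => 1/(m * (1 + α * y)) / (1 - m * y/(1 + α * y))^2) 0 :=
      ContinuousAt.div (ContinuousAt.div (by fun_prop) (by fun_prop) (by simp [hm.ne'])) (by fun_prop) (by simp)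
    have := this.tendsto.comp h0
    simpa [Function.comp_def] using this
  have l5 := ((l4.mul l1).mul l2).mul l3
  have hval : 1/m * (3/2 + m * (3 * m/2 - α)^2) * (1 / (2 * Real.sqrt Real.pi) * m ^ (-(3:ℝ)/2)) * Real.exp (-m * (α - m/2)^2)
    = (1 / (2 * Real.sqrt Real.pi)) * (3 / (2 * m) + (3 * m / 2 - α) ^ 2) *
        m ^ (-(3 : ℝ) / 2) * Real.exp (-m * (α - m / 2) ^ 2) := by
    have : 1/m * (3/2 + m * (3 * m/2 - α)^2) = 3 / (2 * m) + (3 * m / 2 - α) ^ 2 := by field_simp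
    rw [this]; ring
  rw [hval] at l5
  refine l5.congr' ?_
  have g1 : ∀ᶠ N in atTop, 0 < 1 + α * h N := by
    have : Tendsto (fun N => 1 + α * h N) atTop (𝓝 (1 + α * 0)) := (h0.const_mul α).const_add 1
    exact this.eventually (lt_mem_nhds (by simp))
  have g2 : ∀ᶠ N in atTop, 0 < 1 - m * h N/(1 + α * h N) := by
    have k1 : ContinuousAt (fun y : ℝ => 1 - m * y/(1 + α*y)) 0 := 
      ContinuousAt.sub (by fun_prop) (ContinuousAt.div (by fun_prop) (by fun_prop) (by simp))
    exact (k1.tendsto.comp h0).eventually (lt_mem_nhds (by simp))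
  filter_upwards [g1, g2, hN3, eventually_ge_atTop 2, hlim.eventually self_mem_nhdsWithin] with N g1 g2 g3 g4 g5
  have g5 : 0 < h N := g5
  have e1 : (N:ℝ) ^ (-(1:ℝ)/3) = h N := by rw [hh]
  have hNpos : (0:ℝ) < N := by positivity
  have e2 : (N:ℝ) ^ ((2:ℝ)/3) = 1/h N^2 := by
    rw [← e1, ← Real.rpow_natCast, ← Real.rpow_mul hNpos.le, one_div, ← Real.rpow_neg hNpos.le]; norm_num
  have hNe : (N:ℝ) = 1/h N^3 := by field_simp; exact g3
  rw [e1, e2, rhoIm, show -(N:ℝ) * (m * h N)^2 = -(N * (m * h N)^2) by ring]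
  have hL : 0 < Lag (N - 1) 1 (-(N * (m * h N)^2)) := by
    rw [lag_eq N g4]; exact ww_pos N g4 _ (by positivity)
  have hgs : 0 < 1 + (m * h N + (m * h N)^2/2) := by positivity
  have hexp : Real.exp ((Real.log (1 - m*h N/(1+α*h N)) + Real.log (1 + (m*h N+m^2*h N^2/2))
      - m*h N*(1+α*h N-m*h N) + m*h N/(1+m*h N/2)) / h N^3) =
      (1 - m * h N/(1 + α * h N))^(N-2) * (1 - m * h N/(1 + α * h N))^2 * (1 + (m * h N + (m * h N)^2/2))^N *
        Real.exp (-(N:ℝ) * (m * h N) * (1 + α * h N - m * h N)) * Real.exp ((N * (m * h N)^2) / (m * h N + (m * h N)^2/2)) := by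
    rw [← pow_add, show N - 2 + 2 = N by omega]
    have p1 : (1 - m * h N/(1 + α * h N))^N = Real.exp (N * Real.log (1 - m * h N/(1 + α * h N))) := by
      rw [Real.exp_nat_mul, Real.exp_log g2]
    have p2 : (1 + (m * h N + (m * h N)^2/2))^N = Real.exp (N * Real.log (1 + (m * h N + (m * h N)^2/2))) := by
      rw [Real.exp_nat_mul, Real.exp_log hgs]
    rw [p1, p2, ← Real.exp_add, ← Real.exp_add, ← Real.exp_add]
    congr 1
    rw [show m^2 * h N^2 = (m * h N)^2 by ring]
    generalize Real.log (1 - m * h N/(1 + α * h N)) = A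
    generalize Real.log (1 + (m * h N + (m * h N)^2/2)) = B
    have : (N * (m * h N)^2) / (m * h N + (m * h N)^2/2) = N * (m*h N/(1+m*h N/2)) := by field_simp
    rw [this]
    generalize m*h N/(1+m*h N/2) = D
    rw [hNe]; field_simp; ring
  simp only [Function.comp]
  rw [hexp]
  generalize Real.exp (-(N:ℝ) * (m * h N) * (1 + α * h N - m * h N)) = X
  have hZ := Real.exp_pos ((N * (m * h N)^2) / (m * h N + (m * h N)^2/2))
  generalize Real.exp ((N * (m * h N)^2) / (m * h N + (m * h N)^2/2)) = Z at *
  generalize ((N : ℝ) - 1) / (N : ℝ) * (3 * (m * h N) - 2 * (1 + α * h N)) * Lag (N - 1) 1 (-(N * (m * h N)^2))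
      + (2 * (1 + α * h N) - 2 * (m * h N) + (m * h N) * ((1 + α * h N) - (m * h N)) ^ 2) * Lag (N - 2) 1 (-(N * (m * h N)^2)) = W
  generalize Lag (N - 1) 1 (-(N * (m * h N)^2)) = L at *
  have hS : 0 < (1 + (m * h N + (m * h N)^2/2))^N := by positivity
  generalize (1 + (m * h N + (m * h N)^2/2))^N = S at *
  generalize (1 - m * h N/(1 + α * h N)) = V at *
  generalize V^(N-2) = V2
  generalize 1 + α * h N = γ at *
  field_simp
end

section
/- Let N ≥ 1 and let α, β be integers with 0 ≤ α ≤ β ≤ N. For X, Y ∈ ℝ write z = X + iY. Then ∫_{ℝ} e^{−NX²/2} · p_{N−α}(z·√(N/2)) · p_{N−β}(z̄·√(N/2)) dX = i^{β−α} · √(2/N) · √( N^{β−α} / ((N−α)(N−α−1)⋯(N−β+1)) ) · Y^{β−α} · L_{N−β}^{(β−α)}(−NY²), where the product (N−α)(N−α−1)⋯(N−β+1) is understood as the empty product 1 when β = α. -/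
open MeasureTheory

/-- The monic Hermite polynomial `H̃_n(x) = (−1/2)^n · e^{x²} · (d/dx)^n e^{−x²}`,
evaluated at complex arguments (as an entire function it agrees with the polynomial). -/
noncomputable def Htilde (n : ℕ) (z : ℂ) : ℂ :=
  (-(1 : ℂ) / 2) ^ n * Complex.exp (z ^ 2) *
    iteratedDeriv n (fun w : ℂ => Complex.exp (-w ^ 2)) z

/-- The orthonormal Hermite polynomial `p_n(x) = √(2^n/(n!·√π)) · H̃_n(x)`. -/
noncomputable def pHermite (n : ℕ) (z : ℂ) : ℂ :=
  (Real.sqrt (2 ^ n / (Nat.factorial n * Real.sqrt Real.pi)) : ℝ) * Htilde n z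

open Polynomial in
/-- The raising operator `P ↦ X P - P'/2`. -/
noncomputable def raiseOp : Module.End ℂ ℂ[X] :=
  LinearMap.mulLeft ℂ X - (1 / 2 : ℂ) • Polynomial.derivative

open Polynomial in
lemma raiseOp_apply (P : ℂ[X]) : raiseOp P = X * P - C (1 / 2 : ℂ) * derivative P := by
  simp [raiseOp, Polynomial.smul_eq_C_mul]

open Polynomial in
/-- Monic Hermite polynomials, as polynomials. -/
noncomputable def hp (n : ℕ) : ℂ[X] := (raiseOp ^ n) 1

lemma hp_zero : hp 0 = 1 := by simp [hp]

lemma hp_succ (n : ℕ) : hp (n + 1) = raiseOp (hp n) := by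
  simp [hp, pow_succ']

open Polynomial in
lemma hp_deriv (n : ℕ) : derivative (hp (n + 1)) = ((n + 1 : ℕ) : ℂ[X]) * hp n := by
  induction n with
  | zero => simp [hp_succ, hp_zero, raiseOp_apply]
  | succ n ih =>
    rw [hp_succ (n + 1), raiseOp_apply, derivative_sub, derivative_mul, derivative_mul, ih,
      derivative_mul, hp_succ n, raiseOp_apply]
    simp only [derivative_X, derivative_C, derivative_natCast]
    push_cast
    ring

open Polynomial in
lemma hp_deriv' (n : ℕ) : derivative (hp n) = (n : ℂ[X]) * hp (n - 1) := by
  cases n with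
  | zero => simp [hp_zero]
  | succ n => simpa using hp_deriv n

open Polynomial in
lemma iteratedDeriv_gauss (n : ℕ) (z : ℂ) :
    iteratedDeriv n (fun w : ℂ => Complex.exp (-w ^ 2)) z =
      (-2) ^ n * (hp n).eval z * Complex.exp (-z ^ 2) := by
  induction n generalizing z with
  | zero => simp [hp_zero]
  | succ n ih =>
    rw [iteratedDeriv_succ, funext ih]
    have h1 : HasDerivAt (fun w : ℂ => Complex.exp (-w ^ 2))
        (Complex.exp (-z ^ 2) * (-(2 * z))) z := by
      have := ((hasDerivAt_pow 2 z).neg).cexp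
      simpa using this
    have h2 := (((hp n).hasDerivAt z).const_mul ((-2 : ℂ) ^ n)).mul h1
    have h3 := h2.deriv
    refine Eq.trans h3 ?_
    rw [hp_succ, raiseOp_apply]
    simp only [eval_sub, eval_mul, eval_X, eval_C]
    ring

lemma Htilde_eq (n : ℕ) (z : ℂ) : Htilde n z = (hp n).eval z := by
  rw [Htilde, iteratedDeriv_gauss]
  have h1 : Complex.exp (z ^ 2) * Complex.exp (-z ^ 2) = 1 := by
    rw [← Complex.exp_add]; simp
  have h2 : (-(1 : ℂ) / 2) ^ n * (-2) ^ n = 1 := by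
    rw [← mul_pow]; norm_num
  linear_combination (hp n).eval z * ((-(1 : ℂ) / 2) ^ n * (-2) ^ n) * h1 + (hp n).eval z * h2

open Polynomial in
lemma hp_comp (n : ℕ) (a : ℂ) :
    (hp n).comp (X + C a) = ((raiseOp + a • (1 : Module.End ℂ ℂ[X])) ^ n) 1 := by
  induction n with
  | zero => simp [hp_zero]
  | succ n ih =>
    rw [pow_succ', Module.End.mul_apply, ← ih, hp_succ, LinearMap.add_apply, raiseOp_apply,
      raiseOp_apply, derivative_comp]
    simp [Polynomial.smul_eq_C_mul]
    ring

open Polynomial in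
lemma hp_comp_sum (n : ℕ) (a : ℂ) :
    (hp n).comp (X + C a) =
      ∑ k ∈ Finset.range (n + 1), C (a ^ (n - k) * (n.choose k : ℂ)) * hp k := by
  rw [hp_comp, Commute.add_pow]
  · rw [LinearMap.sum_apply]
    refine Finset.sum_congr rfl fun k _ => ?_
    rw [hp, _root_.smul_pow, one_pow, mul_smul_comm, mul_one, smul_mul_assoc, LinearMap.smul_apply,
      ← Nat.cast_comm, ← nsmul_eq_mul, LinearMap.smul_apply, Polynomial.smul_eq_C_mul]
    simp [mul_assoc]
  · exact (Commute.one_right _).smul_right a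

open Polynomial in
lemma gauss_integrable (P : ℂ[X]) :
    Integrable (fun x : ℝ => (Real.exp (-x ^ 2) : ℂ) * P.eval (x : ℂ)) := by
  induction P using Polynomial.induction_on' with
  | add p q hp hq =>
    refine (hp.add hq).congr (Filter.Eventually.of_forall fun x => ?_)
    simp [mul_add]
  | monomial n a =>
    have h := integrable_rpow_mul_exp_neg_mul_sq (b := 1) one_pos (s := n)
      (by have : (0 : ℝ) ≤ n := n.cast_nonneg
          linarith)
    have h2 := (h.ofReal (𝕜 := ℂ)).const_mul a
    refine h2.congr (Filter.Eventually.of_forall fun x => ?_)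
    simp
    ring

open Polynomial in
/-- Gaussian functional. -/
noncomputable def gM (P : ℂ[X]) : ℂ := ∫ x : ℝ, (Real.exp (-x ^ 2) : ℂ) * P.eval (x : ℂ)

open Polynomial in
lemma gM_add (P Q : ℂ[X]) : gM (P + Q) = gM P + gM Q := by
  unfold gM
  rw [← integral_add (gauss_integrable P) (gauss_integrable Q)]
  simp [mul_add]

open Polynomial in
lemma gM_C_mul (a : ℂ) (Q : ℂ[X]) : gM (C a * Q) = a * gM Q := by
  unfold gM
  rw [← integral_const_mul]
  congr 1; ext x
  simp
  ring

open Polynomial in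
lemma gM_sum {ι : Type*} (s : Finset ι) (f : ι → ℂ[X]) :
    gM (∑ i ∈ s, f i) = ∑ i ∈ s, gM (f i) := by
  classical
  induction s using Finset.induction_on with
  | empty => simp [gM]
  | insert a s ha ih => rw [Finset.sum_insert ha, gM_add, ih, Finset.sum_insert ha]

lemma gM_one : gM 1 = (Real.sqrt Real.pi : ℝ) := by
  unfold gM
  have := integral_gaussian 1
  simp only [Polynomial.eval_one, mul_one]
  rw [integral_complex_ofReal]
  simpa using this

open Polynomial in
lemma gM_parts (P : ℂ[X]) : gM (derivative P - 2 * X * P) = 0 := by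
  unfold gM
  refine integral_eq_zero_of_hasDerivAt_of_integrable
    (f := fun x : ℝ => (Real.exp (-x ^ 2) : ℂ) * P.eval (x : ℂ)) ?_
    (gauss_integrable _) (gauss_integrable _)
  intro x
  have h1 : HasDerivAt (fun x : ℝ => Real.exp (-x ^ 2)) (Real.exp (-x ^ 2) * (-(2 * x))) x := by
    have := ((hasDerivAt_pow 2 x).neg).exp
    simpa using this
  have h2 : HasDerivAt (fun x : ℝ => P.eval (x : ℂ)) ((derivative P).eval (x : ℂ)) x :=
    (P.hasDerivAt (x : ℂ)).comp_ofReal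
  have h3 := h1.ofReal_comp.mul h2
  refine h3.congr_deriv ?_
  simp
  ring

open Polynomial in
lemma gM_raise (P Q : ℂ[X]) : gM (raiseOp P * Q) = 1 / 2 * gM (P * derivative Q) := by
  have h := gM_parts (P * Q)
  have e : raiseOp P * Q = C (1 / 2 : ℂ) * (P * derivative Q) +
      C (-1 / 2 : ℂ) * (derivative (P * Q) - 2 * X * (P * Q)) := by
    rw [raiseOp_apply, derivative_mul]
    have h2 : (C (-1 / 2 : ℂ) : ℂ[X]) = - C (1 / 2 : ℂ) := by rw [← C_neg]; norm_num
    have h3 : (C (1 / 2 : ℂ) : ℂ[X]) * 2 = 1 := by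
      rw [show (2 : ℂ[X]) = C 2 from rfl, ← C_mul]; norm_num
    rw [h2]
    linear_combination (-X * P * Q) * h3
  rw [e, gM_add, gM_C_mul, gM_C_mul, h]
  simp

open Polynomial in
lemma gM_hp_mul (k : ℕ) (Q : ℂ[X]) : gM (hp k * Q) = (1 / 2) ^ k * gM (derivative^[k] Q) := by
  induction k generalizing Q with
  | zero => simp [hp_zero]
  | succ k ih =>
    rw [hp_succ, gM_raise, ih, Function.iterate_succ_apply]
    ring

open Polynomial in
lemma gM_comp_mul (m : ℕ) (a : ℂ) (Q : ℂ[X]) :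
    gM ((hp m).comp (X + C a) * Q) = ∑ k ∈ Finset.range (m + 1),
      a ^ (m - k) * (m.choose k : ℂ) * ((1 / 2) ^ k * gM (derivative^[k] Q)) := by
  rw [hp_comp_sum, Finset.sum_mul, gM_sum]
  refine Finset.sum_congr rfl fun k _ => ?_
  rw [mul_assoc, gM_C_mul, gM_hp_mul]

open Polynomial in
lemma gM_comp (j : ℕ) (b : ℂ) :
    gM ((hp j).comp (X + C b)) = b ^ j * (Real.sqrt Real.pi : ℝ) := by
  have h := gM_comp_mul j b 1
  rw [mul_one] at h
  rw [h, Finset.sum_eq_single 0]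
  · simp [gM_one]
  · intro k _ hk
    rw [Polynomial.iterate_derivative_one hk.bot_lt]
    simp [gM]
  · simp

open Polynomial in
lemma iter_deriv_comp (n k : ℕ) (b : ℂ) :
    derivative^[k] ((hp n).comp (X + C b)) =
      C (n.descFactorial k : ℂ) * (hp (n - k)).comp (X + C b) := by
  induction k with
  | zero => simp
  | succ k ih =>
    rw [Function.iterate_succ_apply', ih, derivative_C_mul, derivative_comp, hp_deriv',
      Nat.descFactorial_succ, Nat.sub_sub]
    simp
    ring

open Polynomial in
lemma gM_cross (m n : ℕ) (a b : ℂ) :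
    gM ((hp m).comp (X + C a) * (hp n).comp (X + C b)) = ∑ k ∈ Finset.range (m + 1),
      a ^ (m - k) * (m.choose k : ℂ) * ((1 / 2) ^ k * ((n.descFactorial k : ℂ) *
        (b ^ (n - k) * (Real.sqrt Real.pi : ℝ)))) := by
  rw [gM_comp_mul]
  simp only [iter_deriv_comp, gM_C_mul, gM_comp]

lemma cross_sum (n d : ℕ) (a b : ℂ) (x : ℝ) (hx : (x : ℂ) = -2 * a * b) (s : ℂ) :
    ∑ k ∈ Finset.range (n + d + 1),
      a ^ (n + d - k) * ((n + d).choose k : ℂ) * ((1 / 2) ^ k * ((n.descFactorial k : ℂ) *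
        (b ^ (n - k) * s))) =
    s * (n.factorial : ℂ) * (1 / 2) ^ n * a ^ d * (Lag n d x : ℝ) := by
  rw [show n + d + 1 = (n + 1) + d by ring, Finset.sum_range_add]
  rw [Finset.sum_eq_zero (s := Finset.range d), add_zero]
  · rw [← Finset.sum_range_reflect, Lag]
    push_cast
    rw [Finset.mul_sum]
    refine Finset.sum_congr rfl fun k hk => ?_
    have hk : k ≤ n := by simpa [Nat.lt_succ_iff] using hk
    rw [hx]
    obtain ⟨l, rfl⟩ := Nat.exists_eq_add_of_le hk
    have e2 : k + l + d - l = k + d := by omega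
    have e3 : k + l - l = k := by omega
    have e4 : k + l - k = l := by omega
    rw [e4, e2, e3]
    have h := Nat.factorial_mul_descFactorial (n := k + l) (k := l) (by omega)
    rw [e3] at h
    have h' : (k.factorial : ℂ) * ((k + l).descFactorial l : ℂ) = ((k + l).factorial : ℂ) := by
      exact_mod_cast h
    rw [← h']
    have hf : (k.factorial : ℂ) ≠ 0 := by exact_mod_cast k.factorial_ne_zero
    have e5 : (-1 : ℂ) ^ k * (-2 * a * b) ^ k * (1 / 2) ^ k = a ^ k * b ^ k := by
      rw [← mul_pow, ← mul_pow, ← mul_pow]; congr 1; ring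
    field_simp
    rw [pow_add, pow_add]
    linear_combination (-(a ^ d * ((k + l + d).choose l : ℂ) * (1 / 2) ^ l * s)) * e5
  · intro k _
    rw [Nat.descFactorial_of_lt (by omega)]
    simp

lemma const_id (N n d : ℕ) (hN : 1 ≤ N) :
    Real.sqrt (2 ^ (n + d) / ((n + d).factorial * Real.sqrt Real.pi)) *
      Real.sqrt (2 ^ n / (n.factorial * Real.sqrt Real.pi)) *
      (Real.sqrt Real.pi * n.factorial * (1 / 2) ^ n * Real.sqrt (N / 2) ^ d) =
    Real.sqrt ((N : ℝ) ^ d / (((n + d).factorial : ℝ) / n.factorial)) := by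
  symm
  have hπ : 0 < Real.sqrt Real.pi := Real.sqrt_pos.mpr Real.pi_pos
  have h1 : (0 : ℝ) < n.factorial := by exact_mod_cast n.factorial_pos
  have h2 : (0 : ℝ) < (n + d).factorial := by exact_mod_cast (n + d).factorial_pos
  rw [Real.sqrt_eq_iff_mul_self_eq (by positivity) (by positivity)]
  symm
  have a1 := Real.mul_self_sqrt
    (show 0 ≤ 2 ^ (n + d) / ((n + d).factorial * Real.sqrt Real.pi) by positivity)
  have a2 := Real.mul_self_sqrt
    (show 0 ≤ 2 ^ n / (n.factorial * Real.sqrt Real.pi) by positivity)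
  have a3 := Real.mul_self_sqrt (show 0 ≤ (N : ℝ) / 2 by positivity)
  calc _ = (Real.sqrt (2 ^ (n + d) / ((n + d).factorial * Real.sqrt Real.pi)) *
        Real.sqrt (2 ^ (n + d) / ((n + d).factorial * Real.sqrt Real.pi))) *
      (Real.sqrt (2 ^ n / (n.factorial * Real.sqrt Real.pi)) *
        Real.sqrt (2 ^ n / (n.factorial * Real.sqrt Real.pi))) *
      (Real.sqrt Real.pi * n.factorial * (1 / 2) ^ n) ^ 2 *
        (Real.sqrt (N / 2) * Real.sqrt (N / 2)) ^ d := by ring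
    _ = _ := by
      rw [a1, a2, a3, div_pow, div_pow, one_pow, pow_add]
      field_simp

lemma prod_id (n d : ℕ) :
    ∏ j ∈ Finset.range d, (((n + d : ℕ) : ℝ) - (j : ℝ)) =
      ((n + d).factorial : ℝ) / n.factorial := by
  have h := Nat.factorial_mul_descFactorial (n := n + d) (k := d) (by omega)
  rw [Nat.add_sub_cancel, Nat.descFactorial_eq_prod_range] at h
  have h1 : (n.factorial : ℝ) ≠ 0 := by exact_mod_cast n.factorial_ne_zero
  rw [eq_div_iff h1, ← h]
  push_cast
  rw [mul_comm]
  congr 1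
  refine Finset.prod_congr rfl fun j hj => ?_
  rw [Finset.mem_range] at hj
  rw [Nat.cast_sub (by omega)]
  push_cast
  ring

/-- For `1 ≤ N`, integers `0 ≤ α ≤ β ≤ N`, and `Y ∈ ℝ` (with
`z = X + iY`):
`∫_ℝ e^{−NX²/2} p_{N−α}(z√(N/2)) p_{N−β}(z̄√(N/2)) dX
  = i^{β−α} √(2/N) √(N^{β−α}/((N−α)⋯(N−β+1))) Y^{β−α} L_{N−β}^{(β−α)}(−NY²)`,
where the product `(N−α)(N−α−1)⋯(N−β+1)` is the empty product `1` if `β = α`. -/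
theorem hermite_cross_integral (N α β : ℕ) (hN : 1 ≤ N) (hαβ : α ≤ β) (hβN : β ≤ N)
    (Y : ℝ) :
    (∫ X : ℝ,
        (Real.exp (-(N : ℝ) * X ^ 2 / 2) : ℂ) *
          pHermite (N - α) (((X : ℂ) + (Y : ℂ) * Complex.I) * (Real.sqrt ((N : ℝ) / 2) : ℝ)) *
          pHermite (N - β) (((X : ℂ) - (Y : ℂ) * Complex.I) * (Real.sqrt ((N : ℝ) / 2) : ℝ)))
      = Complex.I ^ (β - α) * (Real.sqrt (2 / (N : ℝ)) : ℝ) *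
        (Real.sqrt ((N : ℝ) ^ (β - α) /
          ∏ j ∈ Finset.range (β - α), ((N : ℝ) - (α : ℝ) - (j : ℝ))) : ℝ) *
        (Y : ℂ) ^ (β - α) * (Lag (N - β) (β - α) (-(N : ℝ) * Y ^ 2) : ℝ) := by
  obtain ⟨d, rfl⟩ := Nat.exists_eq_add_of_le hαβ
  obtain ⟨n, rfl⟩ := Nat.exists_eq_add_of_le hβN
  have e1 : α + d + n - α = n + d := by omega
  have e2 : α + d + n - (α + d) = n := by omega
  have e3 : α + d - α = d := by omega
  rw [e1, e2, e3]
  have e4 : ∏ j ∈ Finset.range d, (((α + d + n : ℕ) : ℝ) - (α : ℝ) - (j : ℝ)) =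
      ((n + d).factorial : ℝ) / n.factorial := by
    rw [← prod_id]
    refine Finset.prod_congr rfl fun j _ => ?_
    push_cast
    ring
  rw [e4]
  generalize α + d + n = N at hN
  have hNpos : (0 : ℝ) < N := by exact_mod_cast hN
  set c : ℝ := Real.sqrt ((N : ℝ) / 2) with hc
  have hcpos : 0 < c := Real.sqrt_pos.mpr (by positivity)
  have hc2 : c * c = N / 2 := Real.mul_self_sqrt (by positivity)
  have hcinv : Real.sqrt (2 / (N : ℝ)) = c⁻¹ := by
    rw [hc, ← Real.sqrt_inv, inv_div]
  set a : ℂ := Complex.I * Y * c with ha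
  set P : Polynomial ℂ := (hp (n + d)).comp (Polynomial.X + Polynomial.C a) *
    (hp n).comp (Polynomial.X + Polynomial.C (-a)) with hP
  set κ : ℂ := (Real.sqrt (2 ^ (n + d) / ((n + d).factorial * Real.sqrt Real.pi)) : ℝ) *
      (Real.sqrt (2 ^ n / (n.factorial * Real.sqrt Real.pi)) : ℝ) with hκ
  have hint : (∫ X : ℝ, (Real.exp (-(N : ℝ) * X ^ 2 / 2) : ℂ) *
          pHermite (n + d) (((X : ℂ) + (Y : ℂ) * Complex.I) * (c : ℝ)) *
          pHermite n (((X : ℂ) - (Y : ℂ) * Complex.I) * (c : ℝ))) =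
      c⁻¹ * (κ * gM P) := by
    have h := Measure.integral_comp_mul_right
      (fun x : ℝ => κ * ((Real.exp (-x ^ 2) : ℂ) * P.eval (x : ℂ))) c
    rw [integral_const_mul (μ := volume) κ (fun y : ℝ => (Real.exp (-y ^ 2) : ℂ) * P.eval (y : ℂ)), abs_of_pos (inv_pos.mpr hcpos), Complex.real_smul] at h
    rw [gM, ← h]
    congr 1
    ext X
    have hx : -(N : ℝ) * X ^ 2 / 2 = -(X * c) ^ 2 := by
      linear_combination X ^ 2 * hc2
    rw [hx, pHermite, pHermite, Htilde_eq, Htilde_eq, hP, Polynomial.eval_mul,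
      Polynomial.eval_comp, Polynomial.eval_comp]
    simp only [Polynomial.eval_add, Polynomial.eval_X, Polynomial.eval_C]
    have f1 : ((X : ℂ) + (Y : ℂ) * Complex.I) * (c : ℝ) = ((X * c : ℝ) : ℂ) + a := by
      rw [ha]; push_cast; ring
    have f2 : ((X : ℂ) - (Y : ℂ) * Complex.I) * (c : ℝ) = ((X * c : ℝ) : ℂ) + -a := by
      rw [ha]; push_cast; ring
    rw [f1, f2, hκ]
    ring
  have hL : ((-(N : ℝ) * Y ^ 2 : ℝ) : ℂ) = -2 * a * (-a) := by
    have hc2' : (c : ℂ) * c = N / 2 := by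
      rw [← Complex.ofReal_mul, hc2]; push_cast; rfl
    rw [ha]
    push_cast
    linear_combination (-2 * (Y : ℂ) ^ 2 * c * c) * Complex.I_sq + 2 * (Y : ℂ) ^ 2 * hc2'
  have hK := congrArg (fun r : ℝ => (r : ℂ)) (const_id N n d hN)
  rw [← hc] at hK
  simp only [Complex.ofReal_mul] at hK
  rw [hint, hP, gM_cross, cross_sum n d a (-a) _ hL, hcinv, ← hK, hκ, ha, mul_pow, mul_pow]
  push_cast
  ring
end
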